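/- arXiv:1605.03347 — 2 statements merged into one kernel-verified Lean document; each statement's English description precedes it below -/
import Mathlib

section
/- For every ε > 0 there is a constant C = C(ε) such that for every squarefree positive integer q and every integer a coprime to q, the least positive squarefree integer n(q,a) congruent to a modulo q satisfies n(q,a) ≤ C · q^(36/25 + ε). -/
theorem exists_card_divisors_le_rpow {ε : ℝ} (hε : 0 < ε) :
    ∃ K : ℝ, 1 ≤ K ∧ ∀ n : ℕ, 0 < n → (n.divisors.card : ℝ) ≤ K * (n : ℝ) ^ ε := by
  have hlog : 0 < Real.log 2 := Real.log_pos one_lt_two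
  set K₀ : ℝ := max 1 (1 / (ε * Real.log 2)) with hK₀
  have hK₀1 : 1 ≤ K₀ := le_max_left _ _
  have hK₀2 : 1 ≤ K₀ * (ε * Real.log 2) := by
    have : 1 / (ε * Real.log 2) ≤ K₀ := le_max_right _ _
    rwa [div_le_iff₀ (by positivity)] at this
  set P : ℕ := ⌈(2 : ℝ) ^ (1 / ε)⌉₊ with hP
  have hsmall (p : ℕ) (hp : 2 ≤ p) (e : ℕ) : (e + 1 : ℝ) ≤ K₀ * ((p : ℝ) ^ ε) ^ e := by
    have h2 : (2 : ℝ) ≤ p := by exact_mod_cast hp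
    have h1 : (2 : ℝ) ^ ε ≤ (p : ℝ) ^ ε := Real.rpow_le_rpow (by norm_num) h2 hε.le
    have h3 : 1 + (e : ℝ) * (ε * Real.log 2) ≤ ((2 : ℝ) ^ ε) ^ e := by
      rw [Real.rpow_def_of_pos two_pos, ← Real.exp_nat_mul]
      linarith [Real.add_one_le_exp ((e : ℝ) * (Real.log 2 * ε))]
    have h4 : ((2 : ℝ) ^ ε) ^ e ≤ ((p : ℝ) ^ ε) ^ e := by gcongr
    have h5 : (e : ℝ) ≤ e * (K₀ * (ε * Real.log 2)) :=
      le_mul_of_one_le_right (by positivity) hK₀2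
    calc (e + 1 : ℝ) ≤ K₀ * (1 + (e : ℝ) * (ε * Real.log 2)) := by linarith
      _ ≤ K₀ * ((p : ℝ) ^ ε) ^ e := by gcongr; exact h3.trans h4
  have hlarge (p : ℕ) (hp : P ≤ p) (e : ℕ) : (e + 1 : ℝ) ≤ ((p : ℝ) ^ ε) ^ e := by
    have h1 : (2 : ℝ) ^ (1 / ε) ≤ p := (Nat.le_ceil _).trans (by exact_mod_cast hp)
    have h2 : (2 : ℝ) ≤ (p : ℝ) ^ ε := by
      calc (2 : ℝ) = ((2 : ℝ) ^ (1 / ε)) ^ ε := by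
            rw [← Real.rpow_mul (by norm_num), one_div_mul_cancel hε.ne', Real.rpow_one]
        _ ≤ _ := Real.rpow_le_rpow (by positivity) h1 hε.le
    calc (e + 1 : ℝ) ≤ 2 ^ e := by exact_mod_cast Nat.lt_two_pow_self
      _ ≤ _ := by gcongr
  refine ⟨K₀ ^ P, one_le_pow₀ hK₀1, fun n hn => ?_⟩
  rw [Nat.card_divisors hn.ne']
  push_cast
  have hfac : (n : ℝ) ^ ε = ∏ p ∈ n.primeFactors, ((p : ℝ) ^ ε) ^ n.factorization p := by
    conv_lhs => rw [← Nat.prod_factorization_pow_eq_self hn.ne']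
    rw [Finsupp.prod, Nat.support_factorization, Nat.cast_prod,
      ← Real.finsetProd_rpow _ _ (fun i _ => by positivity)]
    refine Finset.prod_congr rfl fun p _ => ?_
    rw [Nat.cast_pow, ← Real.rpow_natCast, ← Real.rpow_natCast, ← Real.rpow_mul (by positivity),
      ← Real.rpow_mul (by positivity), mul_comm]
  calc ∏ p ∈ n.primeFactors, ((n.factorization p : ℝ) + 1)
      ≤ ∏ p ∈ n.primeFactors,
          ((if p < P then K₀ else 1) * ((p : ℝ) ^ ε) ^ n.factorization p) := by
        refine Finset.prod_le_prod (fun p _ => by positivity) fun p hp => ?_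
        split_ifs with h
        · exact hsmall p (Nat.prime_of_mem_primeFactors hp).two_le _
        · rw [one_mul]; exact hlarge p (not_lt.1 h) _
    _ = (∏ p ∈ n.primeFactors, if p < P then K₀ else 1) * (n : ℝ) ^ ε := by
        rw [Finset.prod_mul_distrib, hfac]
    _ ≤ K₀ ^ P * (n : ℝ) ^ ε := by
        gcongr
        rw [Finset.prod_ite, Finset.prod_const, Finset.prod_const_one, mul_one]
        refine pow_le_pow_right₀ hK₀1 ?_
        calc _ ≤ (Finset.range P).card := Finset.card_le_card fun p hp => by
              simp only [Finset.mem_filter] at hp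
              exact Finset.mem_range.2 hp.2
          _ = P := Finset.card_range P

theorem sum_gcd_le (q C : ℕ) (hq : q ≠ 0) :
    ∑ x ∈ Finset.Icc 1 C, q.gcd x ≤ q.divisors.card * C := by
  calc ∑ x ∈ Finset.Icc 1 C, q.gcd x
      ≤ ∑ x ∈ Finset.Icc 1 C, ∑ g ∈ q.divisors, if g ∣ x then g else 0 := by
        refine Finset.sum_le_sum fun x _ => ?_
        have h : q.gcd x ∈ q.divisors := Nat.mem_divisors.2 ⟨Nat.gcd_dvd_left _ _, hq⟩
        have := Finset.single_le_sum (f := fun g => if g ∣ x then g else 0)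
          (fun _ _ => Nat.zero_le _) h
        simpa [Nat.gcd_dvd_right] using this
    _ = ∑ g ∈ q.divisors, ∑ x ∈ Finset.Icc 1 C, if g ∣ x then g else 0 := Finset.sum_comm
    _ ≤ ∑ g ∈ q.divisors, C := by
        refine Finset.sum_le_sum fun g _ => ?_
        rw [← Finset.sum_filter, Finset.sum_const, smul_eq_mul]
        have : ((Finset.Icc 1 C).filter (g ∣ ·)).card = C / g := by
          rw [← Nat.Ioc_filter_dvd_card_eq_div]; rfl
        rw [this]
        exact Nat.div_mul_le_self C g
    _ = q.divisors.card * C := by simp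

theorem card_filter_lt_gcd_mul_le (n B G : ℕ) (hn : n ≠ 0) :
    ((Finset.Icc 1 B).filter (fun b => G < b.gcd n)).card * G ≤ n.divisors.card * B := by
  calc ((Finset.Icc 1 B).filter (fun b => G < b.gcd n)).card * G
      ≤ ∑ b ∈ Finset.Icc 1 B, n.gcd b := by
        rw [← smul_eq_mul, ← Finset.sum_const]
        refine (Finset.sum_le_sum (g := fun b => n.gcd b) fun b hb => ?_).trans
          (Finset.sum_le_sum_of_subset (Finset.filter_subset _ _))
        rw [Nat.gcd_comm]
        exact (Finset.mem_filter.1 hb).2.le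
    _ ≤ _ := sum_gcd_le n B hn

theorem card_le_of_pairwise_dvd_sub (A : Finset ℤ) (Z m : ℕ) (hm : 0 < m)
    (hA : ∀ d ∈ A, d.natAbs ≤ Z) (h : ∀ d ∈ A, ∀ d' ∈ A, (m : ℤ) ∣ d - d') :
    A.card ≤ 2 * Z / m + 1 := by
  have hm' : (0 : ℤ) < m := by exact_mod_cast hm
  have key : A.card ≤ (Finset.range (2 * Z / m + 1)).card := by
    refine Finset.card_le_card_of_injOn (fun d => ((d + Z) / m).toNat) (fun d hd => ?_)
      fun d hd d' hd' hdd => ?_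
    · have := hA d hd
      have h0 : 0 ≤ (d + Z) / (m : ℤ) := Int.ediv_nonneg (by omega) hm'.le
      have h1 : d + Z ≤ ((2 * Z : ℕ) : ℤ) := by push_cast; omega
      have h2 : (d + Z) / (m : ℤ) ≤ ((2 * Z / m : ℕ) : ℤ) := by
        rw [Int.natCast_div]
        exact Int.ediv_le_ediv hm' h1
      simp only [Finset.coe_range, Set.mem_Iio]
      generalize 2 * Z / m = k at h2 ⊢
      omega
    · have h1 := hA d hd
      have h2 := hA d' hd'
      have h3 : 0 ≤ (d + Z) / (m : ℤ) := Int.ediv_nonneg (by omega) hm'.le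
      have h4 : 0 ≤ (d' + Z) / (m : ℤ) := Int.ediv_nonneg (by omega) hm'.le
      have h5 : (d + Z) / (m : ℤ) = (d' + Z) / (m : ℤ) := by
        simp only at hdd
        omega
      have h6 : (d + Z) % (m : ℤ) = (d' + Z) % (m : ℤ) := by
        refine Int.ModEq.symm ((Int.modEq_iff_dvd).2 ?_)
        simpa using h d hd d' hd'
      have h7 := Int.emod_add_mul_ediv (d + Z) m
      have h8 := Int.emod_add_mul_ediv (d' + Z) m
      rw [h5, h6] at h7
      linarith
  simpa using key

theorem card_le_of_pairwise_proportional (W : Finset (ℕ × ℤ)) (G : ℕ)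
    (hb : ∀ w ∈ W, 1 ≤ w.1) (hG : ∀ w ∈ W, Int.gcd w.1 w.2 ≤ G)
    (h : ∀ w ∈ W, ∀ w' ∈ W, w.2 * w'.1 = w'.2 * w.1) : W.card ≤ G := by
  have key : W.card ≤ (Finset.Icc 1 G).card := by
    refine Finset.card_le_card_of_injOn (fun w => Int.gcd w.1 w.2) (fun w hw => ?_)
      fun w hw w' hw' hww => ?_
    · have : 0 < Int.gcd w.1 w.2 := Int.gcd_pos_of_ne_zero_left _ (by have := hb w hw; omega)
      simpa using ⟨this, hG w hw⟩
    · have h1 := h w hw w' hw'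
      have hbw := hb w hw
      have hbw' := hb w' hw'
      simp only at hww
      have e1 : (w'.1 : ℤ).natAbs * Int.gcd w.1 w.2 = (w.1 : ℤ).natAbs * Int.gcd w'.1 w'.2 := by
        rw [← Int.gcd_mul_left, ← Int.gcd_mul_left]
        congr 1
        · ring
        · rw [mul_comm, h1, mul_comm]
      have hg : 0 < Int.gcd w.1 w.2 := Int.gcd_pos_of_ne_zero_left _ (by omega)
      rw [← hww] at e1
      have e2 : w'.1 = w.1 := by simpa using Nat.eq_of_mul_eq_mul_right hg e1
      have e3 : w.2 = w'.2 := by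
        rw [e2] at h1
        exact mul_right_cancel₀ (by omega) h1
      exact Prod.ext e2.symm e3
  simpa using key

theorem card_le_of_pairwise_dvd_cross (W : Finset (ℕ × ℤ)) (q Q g B Z G : ℕ)
    (hq : 0 < q) (hQ : Q * g = q) (hBZ : B ^ 2 * Z ≤ q)
    (hb : ∀ w ∈ W, 1 ≤ w.1 ∧ w.1 ≤ B) (hd : ∀ w ∈ W, w.2.natAbs ≤ Z)
    (hG : ∀ w ∈ W, Int.gcd w.1 (q * w.2) ≤ G)
    (h : ∀ w ∈ W, ∀ w' ∈ W, (Q : ℤ) ∣ w.2 * w'.1 - w'.2 * w.1) :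
    W.card ≤ 5 * G * g := by
  have hQ0 : 0 < Q := Nat.pos_of_ne_zero (by rintro rfl; omega)
  have hg0 : 0 < g := Nat.pos_of_ne_zero (by rintro rfl; omega)
  rcases W.eq_empty_or_nonempty with rfl | ⟨w₀, hw₀⟩
  · simp
  have hGd : ∀ w ∈ W, Int.gcd w.1 w.2 ≤ G := fun w hw =>
    (Nat.le_of_dvd (Int.gcd_pos_of_ne_zero_left _ (by have := (hb w hw).1; omega))
      (Int.gcd_dvd_gcd_mul_left_right _ _ _)).trans (hG w hw)
  have hGq : ∀ w ∈ W, Nat.gcd w.1 Q ≤ G := fun w hw => by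
    refine (Nat.le_of_dvd (Int.gcd_pos_of_ne_zero_left _ (by have := (hb w hw).1; omega))
      ?_).trans (hG w hw)
    refine Int.dvd_gcd (a := (w.1 : ℤ)) (by exact_mod_cast Nat.gcd_dvd_left _ _)
      (Dvd.dvd.mul_right ?_ _)
    exact_mod_cast (Nat.gcd_dvd_right _ _).trans (Dvd.intro _ hQ)
  have hG1 : 1 ≤ G := lt_of_lt_of_le (Nat.gcd_pos_of_pos_right _ hQ0) (hGq w₀ hw₀)
  rcases lt_or_ge (2 * B * Z) Q with hlt | hge
  · have : W.card ≤ G := by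
      refine card_le_of_pairwise_proportional W G (fun w hw => (hb w hw).1) hGd
        fun w hw w' hw' => ?_
      have h1 := h w hw w' hw'
      have h2 : (w.2 * w'.1 - w'.2 * w.1).natAbs < (Q : ℤ).natAbs := by
        calc (w.2 * w'.1 - w'.2 * w.1).natAbs ≤ (w.2 * w'.1).natAbs + (w'.2 * w.1).natAbs :=
              Int.natAbs_sub_le _ _
          _ = w.2.natAbs * w'.1 + w'.2.natAbs * w.1 := by simp [Int.natAbs_mul]
          _ ≤ Z * B + Z * B := by
              gcongr
              exacts [hd w hw, (hb w' hw').2, hd w' hw', (hb w hw).2]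
          _ < Q := by linarith
      have := Int.eq_zero_of_dvd_of_natAbs_lt_natAbs h1 h2
      linarith
    nlinarith
  · have hfib : ∀ b ∈ Finset.Icc 1 B,
        (W.filter (fun w => w.1 = b)).card ≤ 2 * Z * G / Q + 1 := by
      intro b hbB
      rcases (W.filter (fun w => w.1 = b)).eq_empty_or_nonempty with he | ⟨w₁, hw₁⟩
      · simp [he]
      rw [Finset.mem_filter] at hw₁
      have hgcd : Nat.gcd b Q ≤ G := hw₁.2 ▸ hGq w₁ hw₁.1
      have hgpos : 0 < Nat.gcd b Q := Nat.gcd_pos_of_pos_right _ hQ0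
      set m := Q / Nat.gcd b Q with hm
      have hmQ : m * Nat.gcd b Q = Q := Nat.div_mul_cancel (Nat.gcd_dvd_right _ _)
      have hm0 : 0 < m := Nat.pos_of_ne_zero (by intro h0; rw [h0] at hmQ; omega)
      have hc : ((W.filter (fun w => w.1 = b)).image Prod.snd).card ≤ 2 * Z / m + 1 := by
        refine card_le_of_pairwise_dvd_sub _ Z m hm0 ?_ ?_
        · intro d hdm
          obtain ⟨w, hw, rfl⟩ := Finset.mem_image.1 hdm
          exact hd w (Finset.mem_filter.1 hw).1
        · intro d hdm d' hdm'
          obtain ⟨w, hw, rfl⟩ := Finset.mem_image.1 hdm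
          obtain ⟨w', hw', rfl⟩ := Finset.mem_image.1 hdm'
          rw [Finset.mem_filter] at hw hw'
          have h1 := h w hw.1 w' hw'.1
          rw [hw.2, hw'.2, ← sub_mul] at h1
          have hcop : IsCoprime (m : ℤ) ((b / Nat.gcd b Q : ℕ) : ℤ) := by
            rw [Nat.isCoprime_iff_coprime]
            exact (Nat.coprime_div_gcd_div_gcd hgpos).symm
          refine hcop.dvd_of_dvd_mul_right ?_
          refine Int.dvd_of_mul_dvd_mul_right (a := ((Nat.gcd b Q : ℕ) : ℤ))
            (by exact_mod_cast hgpos.ne') ?_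
          have e1 : (m : ℤ) * (Nat.gcd b Q : ℕ) = Q := by exact_mod_cast hmQ
          have e2 : ((b / Nat.gcd b Q : ℕ) : ℤ) * (Nat.gcd b Q : ℕ) = b := by
            exact_mod_cast Nat.div_mul_cancel (Nat.gcd_dvd_left _ _)
          rw [e1, mul_assoc, e2]
          exact h1
      rw [Finset.card_image_of_injOn] at hc
      · refine hc.trans (Nat.add_le_add_right ?_ 1)
        rw [Nat.le_div_iff_mul_le hQ0]
        calc 2 * Z / m * Q = 2 * Z / m * m * Nat.gcd b Q := by rw [mul_assoc, hmQ]
          _ ≤ 2 * Z * G := Nat.mul_le_mul (Nat.div_mul_le_self _ _) hgcd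
      · intro w hw w' hw' hww
        simp only [Finset.coe_filter, Set.mem_ofPred_eq] at hw hw'
        exact Prod.ext (hw.2.trans hw'.2.symm) hww
    have hcard : W.card ≤ B * (2 * Z * G / Q + 1) := by
      have := Finset.card_le_mul_card_image_of_maps_to (s := W) (t := Finset.Icc 1 B)
        (f := Prod.fst) (fun w hw => by simpa [Nat.one_le_iff_ne_zero] using hb w hw)
        _ hfib
      rw [Nat.card_Icc, Nat.add_sub_cancel] at this
      linarith
    have h1 : (2 * Z * G / Q) * Q ≤ 2 * Z * G := Nat.div_mul_le_self _ _
    have h2 : W.card * Q ≤ 4 * G * g * Q := by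
      calc W.card * Q ≤ B * (2 * Z * G / Q + 1) * Q := by gcongr
        _ = B * (2 * Z * G / Q * Q + Q) := by ring
        _ ≤ B * (2 * Z * G + 2 * Z * G * B) := ?_
        _ ≤ B * (2 * Z * G * B + 2 * Z * G * B) := ?_
        _ = 4 * G * (B ^ 2 * Z) := by ring
        _ ≤ 4 * G * q := by gcongr
        _ = 4 * G * g * Q := by rw [← hQ]; ring
      · have : 2 * B * Z ≤ 2 * Z * G * B := by
          calc 2 * B * Z = 2 * Z * 1 * B := by ring
            _ ≤ 2 * Z * G * B := by gcongr
        gcongr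
        exact hge.trans this
      · have : 1 ≤ B := (hb w₀ hw₀).1.trans (hb w₀ hw₀).2
        exact Nat.mul_le_mul_left _ (Nat.add_le_add_right (Nat.le_mul_of_pos_right _ this) _)
    have := Nat.le_of_mul_le_mul_right h2 hQ0
    nlinarith

theorem card_le_of_residues_mem (W : Finset (ℕ × ℤ)) (Q k M : ℕ) (hQ : Squarefree Q)
    (s : ∀ p : ℕ, Finset (ZMod p)) (hs : ∀ p ∈ Q.primeFactors, (s p).card ≤ k)
    (hmem : ∀ w ∈ W, ∀ p ∈ Q.primeFactors, ¬ p ∣ w.1 → (w.2 : ZMod p) * (w.1 : ZMod p)⁻¹ ∈ s p)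
    (hM : ∀ W' ⊆ W, (∀ w ∈ W', ∀ w' ∈ W', (Q : ℤ) ∣ w.2 * w'.1 - w'.2 * w.1) → W'.card ≤ M) :
    W.card ≤ (k + 1) ^ Q.primeFactors.card * M := by
  classical
  let F : ℕ × ℤ → ∀ p ∈ Q.primeFactors, Option (ZMod p) := fun w p _ =>
    if p ∣ w.1 then none else some ((w.2 : ZMod p) * (w.1 : ZMod p)⁻¹)
  have hF : ∀ w ∈ W, F w ∈ Q.primeFactors.pi (fun p => (s p).insertNone) := by
    intro w hw
    rw [Finset.mem_pi]
    intro p hp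
    by_cases h : p ∣ w.1
    · simp [F, h]
    · simpa [F, h] using hmem w hw p hp h
  have hcard : (Q.primeFactors.pi (fun p => (s p).insertNone)).card
      ≤ (k + 1) ^ Q.primeFactors.card := by
    rw [Finset.card_pi]
    refine Finset.prod_le_pow_card _ _ _ fun p hp => ?_
    rw [Finset.card_insertNone]
    exact Nat.add_le_add_right (hs p hp) 1
  have hfib : ∀ y ∈ Q.primeFactors.pi (fun p => (s p).insertNone),
      (W.filter (fun w => F w = y)).card ≤ M := by
    intro y _
    refine hM _ (Finset.filter_subset _ _) fun w hw w' hw' => ?_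
    rw [Finset.mem_filter] at hw hw'
    have hww : F w = F w' := hw.2.trans hw'.2.symm
    rw [Int.natCast_dvd, ← Nat.prod_primeFactors_of_squarefree hQ]
    refine Finset.prod_primes_dvd _ (fun p hp => (Nat.prime_of_mem_primeFactors hp).prime)
      fun p hp => ?_
    have hpp := Nat.prime_of_mem_primeFactors hp
    have := Fact.mk hpp
    rw [← Int.natCast_dvd]
    have h1 : F w p hp = F w' p hp := by rw [hww]
    by_cases h : p ∣ w.1 <;> by_cases h' : p ∣ w'.1
    · exact dvd_sub (Dvd.dvd.mul_left (by exact_mod_cast h') _)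
        (Dvd.dvd.mul_left (by exact_mod_cast h) _)
    · simp [F, h, h'] at h1
    · simp [F, h, h'] at h1
    · simp only [F, h, h', if_false, Option.some.injEq] at h1
      rw [← ZMod.intCast_zmod_eq_zero_iff_dvd]
      push_cast
      rw [← ZMod.natCast_eq_zero_iff] at h h'
      field_simp at h1
      linear_combination h1
  calc W.card ≤ M * (Q.primeFactors.pi (fun p => (s p).insertNone)).card :=
        Finset.card_le_mul_card_image_of_maps_to hF M hfib
    _ ≤ (k + 1) ^ Q.primeFactors.card * M := by rw [mul_comm]; gcongr

open Polynomial in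
theorem exists_finset_roots_sum_inv_sq {F : Type*} [Field F] [DecidableEq F] (c : Fin 4 → F)
    (i : Fin 4) (hi : ∀ j, j ≠ i → c i ≠ c j) :
    ∃ s : Finset F, s.card ≤ 12 ∧ ∀ b d : F, b ≠ 0 →
      ((d + b * c 1) * (d + b * c 2) * (d + b * c 3)) ^ 2
      + ((d + b * c 0) * (d + b * c 2) * (d + b * c 3)) ^ 2
      - ((d + b * c 0) * (d + b * c 1) * (d + b * c 3)) ^ 2
      - ((d + b * c 0) * (d + b * c 1) * (d + b * c 2)) ^ 2 = 0 → d * b⁻¹ ∈ s := by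
  set P : F[X] := ((X + C (c 1)) * (X + C (c 2)) * (X + C (c 3))) ^ 2
    + ((X + C (c 0)) * (X + C (c 2)) * (X + C (c 3))) ^ 2
    - ((X + C (c 0)) * (X + C (c 1)) * (X + C (c 3))) ^ 2
    - ((X + C (c 0)) * (X + C (c 1)) * (X + C (c 2))) ^ 2 with hP
  have hdeg : P.natDegree ≤ 12 := by
    rw [hP]; compute_degree; norm_num
  have hP0 : P ≠ 0 := by
    intro h0
    have h1 : P.eval (-c i) = 0 := by rw [h0, eval_zero]
    have h01 := hi 0
    have h02 := hi 1
    have h03 := hi 2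
    have h04 := hi 3
    simp only [hP, eval_add, eval_sub, eval_mul, eval_pow, eval_X, eval_C] at h1
    fin_cases i <;> simp [neg_add_eq_zero] at h1 h01 h02 h03 h04 <;> tauto
  refine ⟨P.roots.toFinset, (Multiset.toFinset_card_le _).trans ((card_roots' P).trans hdeg),
    fun b d hb h => ?_⟩
  rw [Multiset.mem_toFinset, mem_roots hP0, IsRoot.def]
  simp only [hP, eval_add, eval_sub, eval_mul, eval_pow, eval_X, eval_C]
  refine (mul_eq_zero.1 (?_ : b ^ 6 * _ = 0)).resolve_left (pow_ne_zero 6 hb)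
  rw [← h]
  field_simp

open Polynomial in
theorem exists_finset_roots_sum_inv_sqrt {F : Type*} [Field F] [DecidableEq F] (c : Fin 4 → F)
    (i : Fin 4) (hi : ∀ j, j ≠ i → c i ≠ c j) :
    ∃ s : Finset F, s.card ≤ 12 ∧ ∀ b d n₀ n₁ n₂ n₃ : F, b ≠ 0 →
      n₀ = (d + b * c 1) * (d + b * c 2) * (d + b * c 3) →
      n₁ = (d + b * c 0) * (d + b * c 2) * (d + b * c 3) →
      n₂ = (d + b * c 0) * (d + b * c 1) * (d + b * c 3) →
      n₃ = (d + b * c 0) * (d + b * c 1) * (d + b * c 2) →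
      ((n₀ + n₁ - n₂ - n₃) ^ 2 - 4 * n₀ * n₁ - 4 * n₂ * n₃) ^ 2
        - 64 * n₀ * n₁ * n₂ * n₃ = 0 → d * b⁻¹ ∈ s := by
  set N₀ : F[X] := (X + C (c 1)) * (X + C (c 2)) * (X + C (c 3)) with hN₀
  set N₁ : F[X] := (X + C (c 0)) * (X + C (c 2)) * (X + C (c 3)) with hN₁
  set N₂ : F[X] := (X + C (c 0)) * (X + C (c 1)) * (X + C (c 3)) with hN₂
  set N₃ : F[X] := (X + C (c 0)) * (X + C (c 1)) * (X + C (c 2)) with hN₃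
  set P : F[X] := ((N₀ + N₁ - N₂ - N₃) ^ 2 - 4 * N₀ * N₁ - 4 * N₂ * N₃) ^ 2
        - 64 * N₀ * N₁ * N₂ * N₃ with hP
  have hdeg : P.natDegree ≤ 12 := by
    rw [hP, hN₀, hN₁, hN₂, hN₃]; compute_degree
  have hP0 : P ≠ 0 := by
    intro h0
    have h1 : P.eval (-c i) = 0 := by rw [h0, eval_zero]
    have h01 := hi 0
    have h02 := hi 1
    have h03 := hi 2
    have h04 := hi 3
    simp only [hP, hN₀, hN₁, hN₂, hN₃, eval_add, eval_sub, eval_mul, eval_pow, eval_X, eval_C,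
      eval_ofNat] at h1
    fin_cases i <;> simp [neg_add_eq_zero] at h1 h01 h02 h03 h04 <;> tauto
  refine ⟨P.roots.toFinset, (Multiset.toFinset_card_le _).trans ((card_roots' P).trans hdeg),
    fun b d n₀ n₁ n₂ n₃ hb e₀ e₁ e₂ e₃ h => ?_⟩
  rw [Multiset.mem_toFinset, mem_roots hP0, IsRoot.def]
  have key : ∀ x y z : F, (d + b * x) * (d + b * y) * (d + b * z)
      = b ^ 3 * ((d * b⁻¹ + x) * (d * b⁻¹ + y) * (d * b⁻¹ + z)) := by
    intro x y z
    field_simp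
  rw [key] at e₀ e₁ e₂ e₃
  simp only [hP, hN₀, hN₁, hN₂, hN₃, eval_add, eval_sub, eval_mul, eval_pow, eval_X, eval_C,
    eval_ofNat]
  refine (mul_eq_zero.1 (?_ : b ^ 12 * _ = 0)).resolve_left (pow_ne_zero 12 hb)
  rw [← h, e₀, e₁, e₂, e₃]
  ring

/-- Modulo every prime divisor of `q`, the affine lines `c ↦ d + b c` that satisfy the energy
relation `f x₀ + f x₁ = f x₂ + f x₃` at four given parameters, one of which is separated from the
others, lie in at most `12` projective classes with `b` invertible. -/
def SparseRelations (q : ℕ) (T : Finset ℤ) (f : ℤ → ℕ) : Prop :=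
  ∀ p : ℕ, p.Prime → p ∣ q → ∀ (c : Fin 4 → ℤ) (i : Fin 4),
    (∀ j, j ≠ i → ¬ (p : ℤ) ∣ c i - c j) → ∃ s : Finset (ZMod p), s.card ≤ 12 ∧
      ∀ (b : ℕ) (d : ℤ), ¬ p ∣ b → (∀ j, d + b * c j ∈ T) →
        f (d + b * c 0) + f (d + b * c 1) = f (d + b * c 2) + f (d + b * c 3) →
        (d : ZMod p) * (b : ZMod p)⁻¹ ∈ s

theorem intCast_ne_zero_of_gcd_eq_one {p q : ℕ} {a : ℤ} (hp : p.Prime) (hpq : p ∣ q)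
    (ha : Int.gcd a q = 1) : (a : ZMod p) ≠ 0 := by
  rw [Ne, ZMod.intCast_zmod_eq_zero_iff_dvd]
  intro h
  have : p ∣ Int.gcd a q := Int.dvd_gcd h (by exact_mod_cast hpq)
  rw [ha] at this
  exact hp.one_lt.ne' (Nat.dvd_one.1 this)

theorem sparseRelations_of_mul_sq {q : ℕ} {a : ℤ} {T : Finset ℤ} {f : ℤ → ℕ}
    (ha : Int.gcd a q = 1) (hT : ∀ t ∈ T, (q : ℤ) ∣ f t * t ^ 2 - a) :
    SparseRelations q T f := by
  intro p hp hpq c i hi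
  have := Fact.mk hp
  obtain ⟨s, hs, h⟩ := exists_finset_roots_sum_inv_sq (fun j => (c j : ZMod p)) i
    fun j hj hc => hi j hj <| by
      rw [← ZMod.intCast_zmod_eq_zero_iff_dvd]
      push_cast
      rw [hc, sub_self]
  refine ⟨s, hs, fun b d hb hx hf => h b d (by rwa [Ne, ZMod.natCast_eq_zero_iff]) ?_⟩
  have ha0 := intCast_ne_zero_of_gcd_eq_one hp hpq ha
  have hx' : ∀ j, (f (d + b * c j) : ZMod p) * ((d : ZMod p) + b * c j) ^ 2 = a := by
    intro j
    have h1 := (Int.natCast_dvd_natCast.2 hpq).trans (hT _ (hx j))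
    rw [← ZMod.intCast_zmod_eq_zero_iff_dvd] at h1
    push_cast at h1
    exact sub_eq_zero.1 h1
  have hf' : (f (d + b * c 0) : ZMod p) + f (d + b * c 1) = f (d + b * c 2) + f (d + b * c 3) := by
    exact_mod_cast congrArg (Nat.cast (R := ZMod p)) hf
  refine (mul_eq_zero.1 (?_ : (a : ZMod p) * _ = 0)).resolve_left ha0
  have h0 := hx' 0
  have h1 := hx' 1
  have h2 := hx' 2
  have h3 := hx' 3
  generalize (d : ZMod p) + b * c 0 = x₀ at *
  generalize (d : ZMod p) + b * c 1 = x₁ at *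
  generalize (d : ZMod p) + b * c 2 = x₂ at *
  generalize (d : ZMod p) + b * c 3 = x₃ at *
  linear_combination (x₀ * x₁ * x₂ * x₃) ^ 2 * hf' - (x₁ * x₂ * x₃) ^ 2 * h0
    - (x₀ * x₂ * x₃) ^ 2 * h1 + (x₀ * x₁ * x₃) ^ 2 * h2 + (x₀ * x₁ * x₂) ^ 2 * h3

theorem sparseRelations_of_sq_mul {q : ℕ} {a : ℤ} {T : Finset ℤ} {f : ℤ → ℕ}
    (ha : Int.gcd a q = 1) (hT : ∀ t ∈ T, (q : ℤ) ∣ t * (f t : ℤ) ^ 2 - a) :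
    SparseRelations q T f := by
  intro p hp hpq c i hi
  have := Fact.mk hp
  obtain ⟨s, hs, h⟩ := exists_finset_roots_sum_inv_sqrt (fun j => (c j : ZMod p)) i
    fun j hj hc => hi j hj <| by
      rw [← ZMod.intCast_zmod_eq_zero_iff_dvd]
      push_cast
      rw [hc, sub_self]
  refine ⟨s, hs, fun b d hb hx hf => h b d _ _ _ _ (by rwa [Ne, ZMod.natCast_eq_zero_iff])
    rfl rfl rfl rfl ?_⟩
  have ha0 := intCast_ne_zero_of_gcd_eq_one hp hpq ha
  have hx' : ∀ j, ((d : ZMod p) + b * c j) * (f (d + b * c j) : ZMod p) ^ 2 = a := by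
    intro j
    have h1 := (Int.natCast_dvd_natCast.2 hpq).trans (hT _ (hx j))
    rw [← ZMod.intCast_zmod_eq_zero_iff_dvd] at h1
    push_cast at h1
    exact sub_eq_zero.1 h1
  have hf' : (f (d + b * c 0) : ZMod p) + f (d + b * c 1) = f (d + b * c 2) + f (d + b * c 3) := by
    exact_mod_cast congrArg (Nat.cast (R := ZMod p)) hf
  refine (mul_eq_zero.1 (?_ : (a : ZMod p) ^ 4 * _ = 0)).resolve_left (pow_ne_zero 4 ha0)
  have h0 := hx' 0
  have h1 := hx' 1
  have h2 := hx' 2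
  have h3 := hx' 3
  generalize (d : ZMod p) + b * c 0 = x₀ at *
  generalize (d : ZMod p) + b * c 1 = x₁ at *
  generalize (d : ZMod p) + b * c 2 = x₂ at *
  generalize (d : ZMod p) + b * c 3 = x₃ at *
  generalize (f (d + b * c 0) : ZMod p) = y₀ at *
  generalize (f (d + b * c 1) : ZMod p) = y₁ at *
  generalize (f (d + b * c 2) : ZMod p) = y₂ at *
  generalize (f (d + b * c 3) : ZMod p) = y₃ at *
  have key : ∀ A n₀ n₁ n₂ n₃ P : ZMod p, A * n₀ = y₀ ^ 2 * P → A * n₁ = y₁ ^ 2 * P →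
      A * n₂ = y₂ ^ 2 * P → A * n₃ = y₃ ^ 2 * P →
      A ^ 4 * (((n₀ + n₁ - n₂ - n₃) ^ 2 - 4 * n₀ * n₁ - 4 * n₂ * n₃) ^ 2
        - 64 * n₀ * n₁ * n₂ * n₃) = 0 := by
    intro A n₀ n₁ n₂ n₃ P e0 e1 e2 e3
    have : A ^ 4 * (((n₀ + n₁ - n₂ - n₃) ^ 2 - 4 * n₀ * n₁ - 4 * n₂ * n₃) ^ 2
        - 64 * n₀ * n₁ * n₂ * n₃) = (((A * n₀ + A * n₁ - A * n₂ - A * n₃) ^ 2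
        - 4 * (A * n₀) * (A * n₁) - 4 * (A * n₂) * (A * n₃)) ^ 2
        - 64 * (A * n₀) * (A * n₁) * (A * n₂) * (A * n₃)) := by ring
    rw [this, e0, e1, e2, e3, eq_sub_of_add_eq hf']
    ring
  refine key _ _ _ _ _ (x₀ * x₁ * x₂ * x₃) ?_ ?_ ?_ ?_
  · linear_combination -(x₁ * x₂ * x₃) * h0
  · linear_combination -(x₀ * x₂ * x₃) * h1
  · linear_combination -(x₀ * x₁ * x₃) * h2
  · linear_combination -(x₀ * x₁ * x₂) * h3

theorem card_solutions_le {q : ℕ} (hq : Squarefree q) {T : Finset ℤ} {f : ℤ → ℕ}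
    (hS : SparseRelations q T f) {B Z G : ℕ} (hBZ : B ^ 2 * Z ≤ q) (c : Fin 4 → ℤ) (i : Fin 4)
    (W : Finset (ℕ × ℤ)) (hb : ∀ w ∈ W, 1 ≤ w.1 ∧ w.1 ≤ B) (hd : ∀ w ∈ W, w.2.natAbs ≤ Z)
    (hG : ∀ w ∈ W, Int.gcd w.1 (q * w.2) ≤ G) (hW : ∀ w ∈ W, ∀ j, w.2 + w.1 * c j ∈ T)
    (hf : ∀ w ∈ W, f (w.2 + w.1 * c 0) + f (w.2 + w.1 * c 1)
      = f (w.2 + w.1 * c 2) + f (w.2 + w.1 * c 3)) :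
    W.card ≤ 13 ^ q.primeFactors.card *
      (5 * G * q.gcd (∏ j ∈ Finset.univ.erase i, (c i - c j).natAbs)) := by
  set D := ∏ j ∈ Finset.univ.erase i, (c i - c j).natAbs with hD
  set g := q.gcd D with hg
  have hq0 : 0 < q := Nat.pos_of_ne_zero hq.ne_zero
  have hQg : q / g * g = q := Nat.div_mul_cancel (Nat.gcd_dvd_left _ _)
  set Q := q / g with hQ
  have hQq : Q ∣ q := Dvd.intro _ hQg
  have hQsf : Squarefree Q := hq.squarefree_of_dvd hQq
  have hcop : ∀ p ∈ Q.primeFactors, ∀ j, j ≠ i → ¬ (p : ℤ) ∣ c i - c j := by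
    intro p hp j hj h
    have hpp := Nat.prime_of_mem_primeFactors hp
    have hpQ := Nat.dvd_of_mem_primeFactors hp
    have hpD : p ∣ D := (Int.natCast_dvd.1 h).trans
      (Finset.dvd_prod_of_mem (fun j => (c i - c j).natAbs)
        (Finset.mem_erase.2 ⟨hj, Finset.mem_univ j⟩))
    have hpg : p ∣ g := Nat.dvd_gcd (hpQ.trans hQq) hpD
    have : p * p ∣ q := hQg ▸ mul_dvd_mul hpQ hpg
    exact hpp.one_lt.ne' (Nat.isUnit_iff.1 (hq p this))
  have hex : ∀ p : ℕ, ∃ s : Finset (ZMod p), p ∈ Q.primeFactors → s.card ≤ 12 ∧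
      ∀ (b : ℕ) (d : ℤ), ¬ p ∣ b → (∀ j, d + b * c j ∈ T) →
        f (d + b * c 0) + f (d + b * c 1) = f (d + b * c 2) + f (d + b * c 3) →
        (d : ZMod p) * (b : ZMod p)⁻¹ ∈ s := by
    intro p
    by_cases hp : p ∈ Q.primeFactors
    · obtain ⟨s, hs⟩ := hS p (Nat.prime_of_mem_primeFactors hp)
        ((Nat.dvd_of_mem_primeFactors hp).trans hQq) c i (hcop p hp)
      exact ⟨s, fun _ => hs⟩
    · exact ⟨∅, fun h => absurd h hp⟩
  choose s hs using hex
  refine (card_le_of_residues_mem W Q 12 (5 * G * g) hQsf s (fun p hp => (hs p hp).1)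
    (fun w hw p hp hpb => (hs p hp).2 w.1 w.2 hpb (hW w hw) (hf w hw)) ?_).trans ?_
  · intro W' hW' hcross
    exact card_le_of_pairwise_dvd_cross W' q Q g B Z G hq0 hQg hBZ (fun w hw => hb w (hW' hw))
      (fun w hw => hd w (hW' hw)) (fun w hw => hG w (hW' hw)) hcross
  · refine Nat.mul_le_mul_right _ (Nat.pow_le_pow_right (by norm_num) ?_)
    exact Finset.card_le_card (Nat.primeFactors_mono hQq hq0.ne')

theorem sum_gcd_sub_le (q C y : ℕ) (hq : q ≠ 0) (hy : y < C) :
    ∑ x ∈ Finset.range C, (if x = y then 0 else q.gcd ((y : ℤ) - x).natAbs)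
      ≤ 2 * (q.divisors.card * C) := by
  classical
  have h1 : ∑ x ∈ (Finset.range C).filter (fun x => x < y), q.gcd ((y : ℤ) - x).natAbs
      ≤ ∑ x ∈ Finset.Icc 1 C, q.gcd x := by
    rw [← Finset.sum_image (f := fun x => q.gcd x) (g := fun x : ℕ => ((y : ℤ) - x).natAbs)]
    · refine Finset.sum_le_sum_of_subset fun z hz => ?_
      obtain ⟨x, hx, rfl⟩ := Finset.mem_image.1 hz
      simp only [Finset.mem_filter, Finset.mem_range] at hx
      rw [Finset.mem_Icc]
      omega
    · intro x hx x' hx' h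
      simp only [Finset.coe_filter, Finset.mem_range, Set.mem_ofPred_eq] at hx hx' h
      omega
  have h2 : ∑ x ∈ (Finset.range C).filter (fun x => y < x), q.gcd ((y : ℤ) - x).natAbs
      ≤ ∑ x ∈ Finset.Icc 1 C, q.gcd x := by
    rw [← Finset.sum_image (f := fun x => q.gcd x) (g := fun x : ℕ => ((y : ℤ) - x).natAbs)]
    · refine Finset.sum_le_sum_of_subset fun z hz => ?_
      obtain ⟨x, hx, rfl⟩ := Finset.mem_image.1 hz
      simp only [Finset.mem_filter, Finset.mem_range] at hx
      rw [Finset.mem_Icc]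
      omega
    · intro x hx x' hx' h
      simp only [Finset.coe_filter, Finset.mem_range, Set.mem_ofPred_eq] at hx hx' h
      omega
  have h3 := sum_gcd_le q C hq
  calc ∑ x ∈ Finset.range C, (if x = y then 0 else q.gcd ((y : ℤ) - x).natAbs)
      = ∑ x ∈ Finset.range C, ((if x < y then q.gcd ((y : ℤ) - x).natAbs else 0)
          + if y < x then q.gcd ((y : ℤ) - x).natAbs else 0) := by
        refine Finset.sum_congr rfl fun x _ => ?_
        rcases lt_trichotomy x y with h | h | h
        · simp [h, h.ne, h.le]
        · simp [h]
        · simp [h, h.ne', h.le]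
    _ ≤ 2 * (q.divisors.card * C) := by
        rw [Finset.sum_add_distrib, ← Finset.sum_filter, ← Finset.sum_filter]
        linarith

theorem gcd_prod_le {ι : Type*} (q : ℕ) (hq : 0 < q) (s : Finset ι) (x : ι → ℕ) :
    q.gcd (∏ j ∈ s, x j) ≤ ∏ j ∈ s, q.gcd (x j) := by
  classical
  refine Nat.le_of_dvd (Finset.prod_pos fun j _ => Nat.gcd_pos_of_pos_left _ hq) ?_
  induction s using Finset.induction_on with
  | empty => simp
  | insert a s ha ih =>
    rw [Finset.prod_insert ha, Finset.prod_insert ha]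
    exact (Nat.gcd_mul_right_dvd_mul_gcd _ _ _).trans (mul_dvd_mul_left _ ih)

theorem sum_gcd_prod_sub_le (q C : ℕ) (hq : q ≠ 0) (i : Fin 4) :
    ∑ c ∈ (Fintype.piFinset fun _ : Fin 4 => Finset.range C).filter
        (fun c => ∀ j, j ≠ i → c i ≠ c j),
      q.gcd (∏ j ∈ Finset.univ.erase i, ((c i : ℤ) - c j).natAbs)
      ≤ C * (2 * (q.divisors.card * C)) ^ 3 := by
  classical
  let h : ℕ → Fin 4 → ℕ → ℕ := fun y j x =>
    if j = i then (if x = y then 1 else 0) else (if x = y then 0 else q.gcd ((y : ℤ) - x).natAbs)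
  calc _ ≤ ∑ c ∈ (Fintype.piFinset fun _ : Fin 4 => Finset.range C).filter
            (fun c => ∀ j, j ≠ i → c i ≠ c j),
          ∑ y ∈ Finset.range C, ∏ j, h y j (c j) := by
        refine Finset.sum_le_sum fun c hc => ?_
        rw [Finset.mem_filter, Fintype.mem_piFinset] at hc
        refine le_trans ?_ (Finset.single_le_sum (f := fun y => ∏ j, h y j (c j))
          (fun _ _ => Nat.zero_le _) (hc.1 i))
        refine (gcd_prod_le q (Nat.pos_of_ne_zero hq) _ _).trans (le_of_eq ?_)
        rw [← Finset.mul_prod_erase _ _ (Finset.mem_univ i)]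
        simp only [h, if_true, one_mul]
        refine Finset.prod_congr rfl fun j hj => ?_
        rw [if_neg (Finset.ne_of_mem_erase hj), if_neg (hc.2 j (Finset.ne_of_mem_erase hj)).symm]
    _ ≤ ∑ c ∈ Fintype.piFinset fun _ : Fin 4 => Finset.range C,
          ∑ y ∈ Finset.range C, ∏ j, h y j (c j) :=
        Finset.sum_le_sum_of_subset (Finset.filter_subset _ _)
    _ = ∑ y ∈ Finset.range C, ∏ j, ∑ x ∈ Finset.range C, h y j x := by
        rw [Finset.sum_comm]
        refine Finset.sum_congr rfl fun y _ => ?_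
        rw [Finset.prod_univ_sum]
    _ ≤ ∑ y ∈ Finset.range C, (2 * (q.divisors.card * C)) ^ 3 := by
        refine Finset.sum_le_sum fun y hy => ?_
        rw [← Finset.mul_prod_erase _ _ (Finset.mem_univ i)]
        have e1 : ∑ x ∈ Finset.range C, h y i x = 1 := by
          simp only [h, if_true, Finset.sum_ite_eq', hy]
        rw [e1, one_mul]
        refine (Finset.prod_le_pow_card _ _ (2 * (q.divisors.card * C)) fun j hj => ?_).trans
          (le_of_eq (by simp))
        simp only [h, if_neg (Finset.ne_of_mem_erase hj)]
        exact sum_gcd_sub_le q C y hq (Finset.mem_range.1 hy)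
    _ = C * (2 * (q.divisors.card * C)) ^ 3 := by simp

theorem card_filter_paired_le (C : ℕ) :
    ((Fintype.piFinset fun _ : Fin 4 => Finset.range C).filter
      (fun c => ∀ i, ∃ j, j ≠ i ∧ c i = c j)).card ≤ 3 * C ^ 2 := by
  classical
  let R := Finset.range C ×ˢ Finset.range C
  have hsub : (Fintype.piFinset fun _ : Fin 4 => Finset.range C).filter
      (fun c => ∀ i, ∃ j, j ≠ i ∧ c i = c j) ⊆
      R.image (fun r => ![r.1, r.1, r.2, r.2]) ∪ (R.image (fun r => ![r.1, r.2, r.1, r.2]) ∪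
        R.image (fun r => ![r.1, r.2, r.2, r.1])) := by
    intro c hc
    rw [Finset.mem_filter, Fintype.mem_piFinset] at hc
    obtain ⟨hc, h⟩ := hc
    have e : c = ![c 0, c 1, c 2, c 3] := by ext j; fin_cases j <;> rfl
    have h0 := h 0
    have h1 := h 1
    have h2 := h 2
    have h3 := h 3
    simp only [Fin.exists_fin_succ, Fin.isValue] at h0 h1 h2 h3
    simp at h0 h1 h2 h3
    have : (c 0 = c 1 ∧ c 2 = c 3) ∨ (c 0 = c 2 ∧ c 1 = c 3) ∨ (c 0 = c 3 ∧ c 1 = c 2) := by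
      omega
    simp only [Finset.mem_union, Finset.mem_image]
    rcases this with ⟨e1, e2⟩ | ⟨e1, e2⟩ | ⟨e1, e2⟩
    · exact Or.inl ⟨(c 0, c 2), Finset.mem_product.2 ⟨hc 0, hc 2⟩, by rw [e]; simp [e1, e2]⟩
    · exact Or.inr (Or.inl ⟨(c 0, c 1), Finset.mem_product.2 ⟨hc 0, hc 1⟩, by
        rw [e]; simp [e1, e2]⟩)
    · exact Or.inr (Or.inr ⟨(c 0, c 1), Finset.mem_product.2 ⟨hc 0, hc 1⟩, by
        rw [e]; simp [e1, e2]⟩)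
  have hR : R.card = C ^ 2 := by simp [R, sq]
  refine (Finset.card_le_card hsub).trans ((Finset.card_union_le _ _).trans ?_)
  have h1 := Finset.card_union_le (R.image (fun r => ![r.1, r.2, r.1, r.2]))
    (R.image (fun r => ![r.1, r.2, r.2, r.1]))
  have h2 := Finset.card_image_le (s := R) (f := fun r => ![r.1, r.1, r.2, r.2])
  have h3 := Finset.card_image_le (s := R) (f := fun r => ![r.1, r.2, r.1, r.2])
  have h4 := Finset.card_image_le (s := R) (f := fun r => ![r.1, r.2, r.2, r.1])
  omega

theorem card_sq_le_card_mul_card_filter_eq {α β : Type*} [DecidableEq β] (P : Finset α) (g : α → β)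
    (U : Finset β) (hg : ∀ x ∈ P, g x ∈ U) :
    P.card ^ 2 ≤ U.card * ((P ×ˢ P).filter (fun x => g x.1 = g x.2)).card := by
  have h1 : ((P ×ˢ P).filter (fun x => g x.1 = g x.2)).card
      = ∑ u ∈ U, (P.filter (fun x => g x = u)).card ^ 2 := by
    rw [Finset.card_eq_sum_card_fiberwise (f := fun x => g x.1) (t := U)]
    · refine Finset.sum_congr rfl fun u _ => ?_
      rw [sq, ← Finset.card_product]
      congr 1
      ext x
      simp only [Finset.mem_filter, Finset.mem_product]
      constructor
      · rintro ⟨⟨⟨a, b⟩, c⟩, d⟩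
        exact ⟨⟨a, d⟩, b, c ▸ d⟩
      · rintro ⟨⟨a, d⟩, b, c⟩
        exact ⟨⟨⟨a, b⟩, d.trans c.symm⟩, d⟩
    · intro x hx
      simp only [Finset.coe_filter, Finset.mem_product, Set.mem_ofPred_eq] at hx
      exact hg _ hx.1.1
  rw [h1, Finset.card_eq_sum_card_fiberwise hg]
  exact sq_sum_le_card_mul_sum_sq

theorem card_pow_four_le_energy (S : Finset ℕ) (g : ℕ → ℕ) (V : ℕ) (hg : ∀ x ∈ S, g x ≤ V) :
    S.card ^ 4 ≤ (2 * V + 1) * ((Fintype.piFinset fun _ : Fin 4 => S).filter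
      (fun c => g (c 0) + g (c 1) = g (c 2) + g (c 3))).card := by
  classical
  have h1 := card_sq_le_card_mul_card_filter_eq (S ×ˢ S) (fun x => g x.1 + g x.2)
    (Finset.range (2 * V + 1)) fun x hx => by
      rw [Finset.mem_product] at hx
      have := hg _ hx.1
      have := hg _ hx.2
      rw [Finset.mem_range]
      omega
  rw [Finset.card_product, Finset.card_range] at h1
  calc S.card ^ 4 = (S.card * S.card) ^ 2 := by ring
    _ ≤ _ := h1
    _ ≤ _ := by
      refine Nat.mul_le_mul_left _ (Finset.card_le_card_of_injOn
        (fun x => ![x.1.1, x.1.2, x.2.1, x.2.2]) (fun x hx => ?_) fun x _ y _ hxy => ?_)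
      · simp only [Finset.coe_filter, Finset.mem_product, Set.mem_ofPred_eq] at hx
        simp only [Finset.coe_filter, Fintype.mem_piFinset, Set.mem_ofPred_eq]
        refine ⟨fun j => ?_, by simpa using hx.2⟩
        fin_cases j
        exacts [hx.1.1.1, hx.1.1.2, hx.1.2.1, hx.1.2.2]
      · have h0 := congrFun hxy 0
        have h1 := congrFun hxy 1
        have h2 := congrFun hxy 2
        have h3 := congrFun hxy 3
        exact Prod.ext (Prod.ext h0 h1) (Prod.ext h2 h3)

theorem sum_pow_four_le {ι : Type*} (I : Finset ι) (s : ι → ℕ) :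
    (∑ w ∈ I, s w) ^ 4 ≤ I.card ^ 3 * ∑ w ∈ I, s w ^ 4 := by
  have h1 : (∑ w ∈ I, s w) ^ 2 ≤ I.card * ∑ w ∈ I, s w ^ 2 := sq_sum_le_card_mul_sum_sq
  have h2 : (∑ w ∈ I, s w ^ 2) ^ 2 ≤ I.card * ∑ w ∈ I, (s w ^ 2) ^ 2 := sq_sum_le_card_mul_sum_sq
  calc (∑ w ∈ I, s w) ^ 4 = ((∑ w ∈ I, s w) ^ 2) ^ 2 := by ring
    _ ≤ (I.card * ∑ w ∈ I, s w ^ 2) ^ 2 := by gcongr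
    _ = I.card ^ 2 * (∑ w ∈ I, s w ^ 2) ^ 2 := by ring
    _ ≤ I.card ^ 2 * (I.card * ∑ w ∈ I, (s w ^ 2) ^ 2) := by gcongr
    _ = I.card ^ 3 * ∑ w ∈ I, s w ^ 4 := by
      simp only [← pow_mul]
      ring

/-- The affine lines `c ↦ d + b c` with `1 ≤ b ≤ B`, `|d| ≤ Z` whose slope has at most the common
factor `G` with `q d`. -/
noncomputable def lineParams (q B Z G : ℕ) : Finset (ℕ × ℤ) :=
  (Finset.Icc 1 B ×ˢ Finset.Icc (-(Z : ℤ)) Z).filter (fun w => Int.gcd w.1 (q * w.2) ≤ G)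

theorem mem_lineParams {q B Z G : ℕ} {w : ℕ × ℤ} : w ∈ lineParams q B Z G ↔
    ((1 ≤ w.1 ∧ w.1 ≤ B) ∧ w.2.natAbs ≤ Z) ∧ Int.gcd w.1 (q * w.2) ≤ G := by
  rw [lineParams, Finset.mem_filter, Finset.mem_product, Finset.mem_Icc, Finset.mem_Icc]
  have : (-(Z : ℤ) ≤ w.2 ∧ w.2 ≤ Z) ↔ w.2.natAbs ≤ Z := by omega
  rw [this]

theorem card_lineParams_le {q B Z G : ℕ} (hZ : 1 ≤ Z) :
    (lineParams q B Z G).card ≤ 3 * B * Z := by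
  refine (Finset.card_filter_le _ _).trans ?_
  rw [Finset.card_product, Nat.card_Icc, Int.card_Icc]
  have : ((Z : ℤ) + 1 - (-(Z : ℤ))).toNat ≤ 3 * Z := by omega
  calc (B + 1 - 1) * ((Z : ℤ) + 1 - (-(Z : ℤ))).toNat ≤ B * (3 * Z) :=
        Nat.mul_le_mul (by omega) this
    _ = 3 * B * Z := by ring

theorem card_mul_le_sum_card_lines {q B C Z G : ℕ} (hq : q ≠ 0) (T : Finset ℤ)
    (hT : ∀ t ∈ T, 1 ≤ t ∧ t ≤ Z) (hBC : B * C ≤ Z)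
    (hG : ∀ t ∈ T, 2 * (q * t.natAbs).divisors.card ≤ G) :
    T.card * B * C ≤ 2 * ∑ w ∈ lineParams q B Z G,
      ((Finset.range C).filter (fun c : ℕ => w.2 + w.1 * (c : ℤ) ∈ T)).card := by
  classical
  let good : ℤ → Finset ℕ := fun t => (Finset.Icc 1 B).filter (fun b => b.gcd (q * t.natAbs) ≤ G)
  have hgood : ∀ t ∈ T, B ≤ 2 * (good t).card := by
    intro t ht
    have h0 := (hT t ht).1
    have hn : q * t.natAbs ≠ 0 := mul_ne_zero hq (by omega)
    have h1 := card_filter_lt_gcd_mul_le (q * t.natAbs) B G hn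
    have h2 := Finset.card_filter_add_card_filter_not (s := Finset.Icc 1 B)
      (fun b => b.gcd (q * t.natAbs) ≤ G)
    simp only [not_le, Nat.card_Icc, Nat.add_sub_cancel] at h2
    set bad := ((Finset.Icc 1 B).filter (fun b => G < b.gcd (q * t.natAbs))).card
    have h3 := hG t ht
    have h4 : 0 < (q * t.natAbs).divisors.card := Finset.card_pos.2 (Nat.nonempty_divisors.2 hn)
    have h5 : 2 * bad * G ≤ B * G := by nlinarith
    have h6 := Nat.le_of_mul_le_mul_right h5 (by omega)
    change B ≤ 2 * ((Finset.Icc 1 B).filter (fun b => b.gcd (q * t.natAbs) ≤ G)).card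
    omega
  have hinj : (T.sigma fun t => good t ×ˢ Finset.range C).card
      ≤ ((lineParams q B Z G).sigma fun w =>
        (Finset.range C).filter (fun c : ℕ => w.2 + w.1 * (c : ℤ) ∈ T)).card := by
    refine Finset.card_le_card_of_injOn
      (fun x => ⟨(x.2.1, x.1 - x.2.1 * (x.2.2 : ℤ)), x.2.2⟩) ?_ ?_
    · rintro ⟨t, b, c⟩ hx
      simp only [Finset.coe_sigma, Set.mem_sigma_iff, Finset.mem_coe, Finset.mem_product, good,
        Finset.mem_filter, Finset.mem_range, Finset.mem_Icc] at hx ⊢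
      obtain ⟨ht, ⟨hb, hg⟩, hc⟩ := hx
      have h0 := hT t ht
      have hbc : b * c ≤ Z := (Nat.mul_le_mul hb.2 hc.le).trans hBC
      have hbc' : (b : ℤ) * c ≤ Z := by exact_mod_cast hbc
      have hbc0 : (0 : ℤ) ≤ (b : ℤ) * c := by positivity
      refine ⟨mem_lineParams.2 ⟨⟨hb, ?_⟩, ?_⟩, hc, by simpa using ht⟩
      · change (t - b * (c : ℤ)).natAbs ≤ Z
        omega
      · change Int.gcd (b : ℤ) (q * (t - b * c)) ≤ G
        have : (q : ℤ) * (t - b * c) = q * t - b * (q * c) := by ring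
        rw [this, Int.gcd_sub_mul_left_right]
        rw [Int.gcd_def, Int.natAbs_mul, Int.natAbs_natCast, Int.natAbs_natCast]
        exact hg
    · rintro ⟨t, b, c⟩ _ ⟨t', b', c'⟩ _ h
      simp only [Sigma.mk.injEq, Prod.mk.injEq, heq_eq_eq] at h
      obtain ⟨⟨rfl, h⟩, rfl⟩ := h
      have : t = t' := by linarith
      subst this
      rfl
  rw [Finset.card_sigma, Finset.card_sigma] at hinj
  calc T.card * B * C = ∑ t ∈ T, B * C := by rw [Finset.sum_const, smul_eq_mul, mul_assoc]
    _ ≤ ∑ t ∈ T, 2 * (good t ×ˢ Finset.range C).card := by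
        refine Finset.sum_le_sum fun t ht => ?_
        rw [Finset.card_product, Finset.card_range, ← mul_assoc]
        exact Nat.mul_le_mul_right _ (hgood t ht)
    _ ≤ _ := by
        rw [← Finset.mul_sum]
        exact Nat.mul_le_mul_left _ hinj

theorem card_pow_four_le_of_sparseRelations {q B C Z G V : ℕ} (hq : Squarefree q) (hZ : 1 ≤ Z)
    {T : Finset ℤ} (hT : ∀ t ∈ T, 1 ≤ t ∧ t ≤ Z) (hBC : B * C ≤ Z) (hBZ : B ^ 2 * Z ≤ q)
    (hG : ∀ t ∈ T, 2 * (q * t.natAbs).divisors.card ≤ G) {f : ℤ → ℕ} (hf : ∀ t ∈ T, f t ≤ V)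
    (hS : SparseRelations q T f) :
    (T.card * B * C) ^ 4 ≤ 16 * ((3 * B * Z) ^ 3 * ((2 * V + 1) *
      (3 * C ^ 2 * (3 * B * Z) + 4 * (13 ^ q.primeFactors.card * (5 * G *
        (C * (2 * (q.divisors.card * C)) ^ 3)))))) := by
  classical
  set I := lineParams q B Z G with hI
  let X := Fintype.piFinset fun _ : Fin 4 => Finset.range C
  let S : ℕ × ℤ → Finset ℕ := fun w =>
    (Finset.range C).filter (fun c : ℕ => w.2 + w.1 * (c : ℤ) ∈ T)
  let r : ℕ × ℤ → (Fin 4 → ℕ) → Prop := fun w c => (∀ j, w.2 + w.1 * (c j : ℤ) ∈ T) ∧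
    f (w.2 + w.1 * (c 0 : ℤ)) + f (w.2 + w.1 * (c 1 : ℤ))
      = f (w.2 + w.1 * (c 2 : ℤ)) + f (w.2 + w.1 * (c 3 : ℤ))
  have hIcard : I.card ≤ 3 * B * Z := card_lineParams_le hZ
  have h1 : T.card * B * C ≤ 2 * ∑ w ∈ I, (S w).card :=
    card_mul_le_sum_card_lines hq.ne_zero T hT hBC hG
  have h2 : ∀ w ∈ I, (S w).card ^ 4 ≤ (2 * V + 1) * (X.filter (r w)).card := by
    intro w _
    refine (card_pow_four_le_energy (S w) (fun c => f (w.2 + w.1 * (c : ℤ))) V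
      fun x hx => hf _ (Finset.mem_filter.1 hx).2).trans
      (Nat.mul_le_mul_left _ (Finset.card_le_card fun c hc => ?_))
    simp only [Finset.mem_filter, Fintype.mem_piFinset, S] at hc
    simp only [Finset.mem_filter, Fintype.mem_piFinset, X, r]
    exact ⟨fun j => (hc.1 j).1, fun j => (hc.1 j).2, hc.2⟩
  have h3 : ∑ w ∈ I, (X.filter (r w)).card = ∑ c ∈ X, (I.filter (fun w => r w c)).card :=
    Finset.sum_card_bipartiteAbove_eq_sum_card_bipartiteBelow r
  have h4 : ∀ (c : Fin 4 → ℕ) (i : Fin 4), (I.filter (fun w => r w c)).card ≤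
      13 ^ q.primeFactors.card *
        (5 * G * q.gcd (∏ j ∈ Finset.univ.erase i, ((c i : ℤ) - c j).natAbs)) := by
    intro c i
    refine card_solutions_le hq hS hBZ (fun j => (c j : ℤ)) i _ (fun w hw => ?_) (fun w hw => ?_)
      (fun w hw => ?_) (fun w hw => ?_) (fun w hw => ?_) <;> rw [Finset.mem_filter] at hw
    · exact (mem_lineParams.1 hw.1).1.1
    · exact (mem_lineParams.1 hw.1).1.2
    · exact (mem_lineParams.1 hw.1).2
    · exact hw.2.1
    · exact hw.2.2
  have h5 : ∑ c ∈ X, (I.filter (fun w => r w c)).card ≤ 3 * C ^ 2 * (3 * B * Z)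
      + 4 * (13 ^ q.primeFactors.card * (5 * G * (C * (2 * (q.divisors.card * C)) ^ 3))) := by
    have h6 : ∀ c ∈ X, (I.filter (fun w => r w c)).card ≤
        (if ∀ i, ∃ j, j ≠ i ∧ c i = c j then 3 * B * Z else 0) +
        ∑ i, if ∀ j, j ≠ i → c i ≠ c j then 13 ^ q.primeFactors.card *
        (5 * G * q.gcd (∏ j ∈ Finset.univ.erase i, ((c i : ℤ) - c j).natAbs)) else 0 := by
      intro c _
      by_cases hc : ∀ i, ∃ j, j ≠ i ∧ c i = c j
      · rw [if_pos hc]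
        exact ((Finset.card_filter_le _ _).trans hIcard).trans (Nat.le_add_right _ _)
      · rw [if_neg hc, zero_add]
        push Not at hc
        obtain ⟨i, hi⟩ := hc
        refine le_trans ?_ (Finset.single_le_sum (fun _ _ => Nat.zero_le _) (Finset.mem_univ i))
        rw [if_pos hi]
        exact h4 c i
    refine (Finset.sum_le_sum h6).trans ?_
    rw [Finset.sum_add_distrib, Finset.sum_comm]
    refine Nat.add_le_add ?_ ?_
    · rw [← Finset.sum_filter, Finset.sum_const, smul_eq_mul]
      exact Nat.mul_le_mul_right _ (card_filter_paired_le C)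
    · refine (Finset.sum_le_card_nsmul _ _ (13 ^ q.primeFactors.card *
        (5 * G * (C * (2 * (q.divisors.card * C)) ^ 3))) fun i _ => ?_).trans (by simp)
      rw [← Finset.sum_filter, ← Finset.mul_sum, ← Finset.mul_sum]
      gcongr
      exact sum_gcd_prod_sub_le q C hq.ne_zero i
  calc (T.card * B * C) ^ 4 ≤ (2 * ∑ w ∈ I, (S w).card) ^ 4 := by gcongr
    _ = 16 * (∑ w ∈ I, (S w).card) ^ 4 := by ring
    _ ≤ 16 * (I.card ^ 3 * ∑ w ∈ I, (S w).card ^ 4) := by gcongr; exact sum_pow_four_le _ _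
    _ ≤ 16 * ((3 * B * Z) ^ 3 * ∑ w ∈ I, (2 * V + 1) * (X.filter (r w)).card) := by
        gcongr with w hw
        exact h2 w hw
    _ ≤ _ := by
        rw [← Finset.mul_sum, h3]
        gcongr

theorem thirteen_pow_card_primeFactors_le {q : ℕ} (hq : q ≠ 0) :
    13 ^ q.primeFactors.card ≤ q.divisors.card ^ 4 := by
  have h : 2 ^ q.primeFactors.card ≤ q.divisors.card := by
    rw [Nat.card_divisors hq, ← Finset.prod_const]
    refine Finset.prod_le_prod' fun p hp => ?_
    have := (Nat.prime_of_mem_primeFactors hp).factorization_pos_of_dvd hq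
      (Nat.dvd_of_mem_primeFactors hp)
    omega
  calc 13 ^ q.primeFactors.card ≤ (2 ^ 4) ^ q.primeFactors.card := by gcongr; norm_num
    _ = (2 ^ q.primeFactors.card) ^ 4 := by rw [← pow_mul, ← pow_mul, mul_comm]
    _ ≤ q.divisors.card ^ 4 := by gcongr

theorem exists_cube_le_and_lt_cube (Z : ℕ) : ∃ B, B ^ 3 ≤ Z ∧ Z < (B + 1) ^ 3 := by
  induction Z with
  | zero => exact ⟨0, by norm_num⟩
  | succ n ih =>
    obtain ⟨B, h1, h2⟩ := ih
    rcases lt_or_ge (n + 1) ((B + 1) ^ 3) with h | h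
    · exact ⟨B, by omega, h⟩
    · refine ⟨B + 1, h, ?_⟩
      have : (B + 1) ^ 3 < (B + 1 + 1) ^ 3 := Nat.pow_lt_pow_left (by omega) (by norm_num)
      omega

theorem card_pow_twelve_le_of_sparseRelations {q Z V D : ℕ} (hq : Squarefree q) (hZ : 1 ≤ Z)
    (hV : 1 ≤ V) (hZq : Z ^ 2 ≤ q) {T : Finset ℤ} (hT : ∀ t ∈ T, 1 ≤ t ∧ t ≤ Z)
    (hD : ∀ n, 0 < n → n ≤ q ^ 2 → n.divisors.card ≤ D) {f : ℤ → ℕ} (hf : ∀ t ∈ T, f t ≤ V)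
    (hS : SparseRelations q T f) :
    T.card ^ 12 ≤ 8 * 6822144 ^ 3 * V ^ 3 * D ^ 24 * Z ^ 8 := by
  have hq0 : 0 < q := Nat.pos_of_ne_zero hq.ne_zero
  obtain ⟨B, hB1, hB2⟩ := exists_cube_le_and_lt_cube Z
  have hB : 1 ≤ B := by
    rcases Nat.eq_zero_or_pos B with rfl | h
    · norm_num at hB2; omega
    · exact h
  have hBZ : B ≤ Z := (Nat.le_self_pow (by norm_num) B).trans hB1
  have hZ8 : Z ≤ 8 * B ^ 3 := by
    calc Z ≤ (B + 1) ^ 3 := hB2.le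
      _ ≤ (B + B) ^ 3 := by gcongr
      _ = 8 * B ^ 3 := by ring
  set C := Z / B with hC
  have hBC : B * C ≤ Z := Nat.mul_div_le Z B
  have hZBC : Z ≤ 2 * (B * C) := by
    have h1 : 1 ≤ C := (Nat.one_le_div_iff hB).2 hBZ
    have h2 := Nat.lt_mul_div_succ Z hB
    rw [← hC] at h2
    nlinarith
  have hB2Z : B ^ 2 * Z ≤ q := by
    calc B ^ 2 * Z ≤ B ^ 3 * Z := by gcongr; omega
      _ ≤ Z * Z := by gcongr
      _ ≤ q := by rwa [← sq]
  have hqq : q ≤ q ^ 2 := Nat.le_self_pow (by norm_num) q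
  have hDq : q.divisors.card ≤ D := hD q hq0 hqq
  have hD1 : 1 ≤ D := (Finset.card_pos.2 (Nat.nonempty_divisors.2 hq0.ne')).trans_le hDq
  have hZq' : Z ≤ q := (Nat.le_self_pow (by norm_num) Z).trans hZq
  have main := card_pow_four_le_of_sparseRelations (G := 2 * D) hq hZ hT hBC hB2Z
    (fun t ht => Nat.mul_le_mul_left 2 (hD _ (Nat.mul_pos hq0 (by have := hT t ht; omega)) (by
      rw [sq]
      exact Nat.mul_le_mul_left _ (by have := hT t ht; omega)))) hf hS
  set N := T.card
  have h13 : 13 ^ q.primeFactors.card ≤ D ^ 4 :=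
    (thirteen_pow_card_primeFactors_le hq0.ne').trans (by gcongr)
  have h1 : (N * B * C) ^ 4 ≤ 16 * ((3 * B * Z) ^ 3 * (3 * V *
      (3 * C ^ 2 * (3 * B * Z) + 4 * (D ^ 4 * (5 * (2 * D) * (C * (2 * (D * C)) ^ 3)))))) := by
    refine main.trans ?_
    gcongr
    omega
  have h2 : N ^ 4 * B * Z ^ 4 ≤ 6822144 * V * D ^ 8 * Z ^ 3 * Z ^ 4 := by
    calc N ^ 4 * B * Z ^ 4 ≤ N ^ 4 * B * (2 * (B * C)) ^ 4 := by gcongr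
      _ = 16 * B * (N * B * C) ^ 4 := by ring
      _ ≤ 16 * B * (16 * ((3 * B * Z) ^ 3 * (3 * V * (3 * C ^ 2 * (3 * B * Z) +
          4 * (D ^ 4 * (5 * (2 * D) * (C * (2 * (D * C)) ^ 3))))))) := by gcongr
      _ = 20736 * V * Z ^ 3 * (9 * (B * C) ^ 2 * B ^ 3 * Z + 320 * D ^ 8 * (B * C) ^ 4) := by ring
      _ ≤ 20736 * V * Z ^ 3 * (9 * Z ^ 2 * Z * Z * D ^ 8 + 320 * D ^ 8 * Z ^ 4) := by
          refine Nat.mul_le_mul_left _ (Nat.add_le_add ?_ (by gcongr))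
          calc 9 * (B * C) ^ 2 * B ^ 3 * Z ≤ 9 * Z ^ 2 * Z * Z * 1 := by rw [mul_one]; gcongr
            _ ≤ 9 * Z ^ 2 * Z * Z * D ^ 8 := by gcongr; exact Nat.one_le_pow _ _ hD1
      _ = 6822144 * V * D ^ 8 * Z ^ 3 * Z ^ 4 := by ring
  have h3 : N ^ 4 * B ≤ 6822144 * V * D ^ 8 * Z ^ 3 :=
    Nat.le_of_mul_le_mul_right h2 (by positivity)
  refine Nat.le_of_mul_le_mul_right (c := Z) ?_ hZ
  calc N ^ 12 * Z ≤ N ^ 12 * (8 * B ^ 3) := by gcongr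
    _ = 8 * (N ^ 4 * B) ^ 3 := by ring
    _ ≤ 8 * (6822144 * V * D ^ 8 * Z ^ 3) ^ 3 := by gcongr
    _ = 8 * 6822144 ^ 3 * V ^ 3 * D ^ 24 * Z ^ 8 * Z := by ring

theorem card_le_card_divisors_of_sq_modEq {q : ℕ} (hq : Squarefree q) (A : Finset ℤ)
    (hA : ∀ x ∈ A, 0 ≤ x ∧ x < q) (h : ∀ x ∈ A, ∀ y ∈ A, (q : ℤ) ∣ x ^ 2 - y ^ 2) :
    A.card ≤ q.divisors.card := by
  rcases A.eq_empty_or_nonempty with rfl | ⟨y, hy⟩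
  · simp
  refine Finset.card_le_card_of_injOn (fun x => Int.gcd q (x - y)) (fun x hx => ?_)
    fun x hx x' hx' hxx => ?_
  · exact Finset.mem_coe.2 (Nat.mem_divisors.2
      ⟨by exact_mod_cast Int.gcd_dvd_left (q : ℤ) (x - y), hq.ne_zero⟩)
  · simp only at hxx
    have hq0 : 0 < q := Nat.pos_of_ne_zero hq.ne_zero
    set g := Int.gcd q (x - y) with hg
    have hg0 : 0 < g := Int.gcd_pos_of_ne_zero_left _ (by exact_mod_cast hq0.ne')
    have hgq : g ∣ q := by exact_mod_cast Int.gcd_dvd_left (q : ℤ) (x - y)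
    obtain ⟨m, hm⟩ := hgq
    have hcop : Nat.Coprime g m := Nat.coprime_of_squarefree_mul (hm ▸ hq)
    have key : ∀ z ∈ A, g = Int.gcd q (z - y) → (m : ℤ) ∣ z + y := by
      intro z hz hgz
      have h1 := h z hz y hy
      rw [sq_sub_sq, mul_comm] at h1
      have h2 : IsCoprime ((q : ℤ) / g) ((z - y) / g) := by
        rw [Int.isCoprime_iff_gcd_eq_one, hgz]
        exact Int.gcd_ediv_gcd_ediv_gcd (by rw [← hgz]; exact hg0)
      have h3 : (q : ℤ) / g = m := by
        rw [hm]
        push_cast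
        exact Int.mul_ediv_cancel_left _ (by exact_mod_cast hg0.ne')
      rw [h3] at h2
      have h4 : (g : ℤ) ∣ z - y := by rw [hgz]; exact Int.gcd_dvd_right _ _
      refine h2.dvd_of_dvd_mul_left ?_
      refine Int.dvd_of_mul_dvd_mul_left (a := (g : ℤ)) (by exact_mod_cast hg0.ne') ?_
      rw [← mul_assoc, Int.mul_ediv_cancel' h4]
      rw [hm] at h1
      exact_mod_cast h1
    have h1 := key x hx rfl
    have h2 := key x' hx' hxx
    have h3 : (g : ℤ) ∣ x - y := Int.gcd_dvd_right _ _
    have h4 : (g : ℤ) ∣ x' - y := by rw [hxx]; exact Int.gcd_dvd_right _ _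
    have h5 : (m : ℤ) ∣ x - x' := by simpa using dvd_sub h1 h2
    have h6 : (g : ℤ) ∣ x - x' := by simpa using dvd_sub h3 h4
    have h7 : (q : ℤ) ∣ x - x' := by
      rw [hm]
      push_cast
      exact (Nat.isCoprime_iff_coprime.2 hcop).mul_dvd h6 h5
    have := hA x hx
    have := hA x' hx'
    have := Int.eq_zero_of_abs_lt_dvd h7 (by rw [abs_lt]; omega)
    omega

theorem card_pow_le_of_cube_le {q a L X Y D : ℕ} (hq : Squarefree q) (ha : Nat.gcd a q = 1)
    (hL : 64 ≤ L) (hLq : 256 * L ^ 2 ≤ q) (hX : X = 2 * q * L)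
    (hD : ∀ n, 0 < n → n ≤ q ^ 2 → n.divisors.card ≤ D) (S : Finset ℕ) (d m : ℕ → ℕ)
    (hS : ∀ l ∈ S, 1 ≤ l ∧ l ≤ L) (hdm : ∀ l ∈ S, d l ^ 2 * m l = a + q * l)
    (hn : ∀ l ∈ S, a + q * l < X)
    (hY : ∀ l ∈ S, Y ≤ d l ∧ d l < 2 * Y) (hLd : ∀ l ∈ S, L < 8 * d l) (hYX : Y ^ 3 ≤ X) :
    S.card ^ 36 ≤ (8 * 6822144 ^ 3) ^ 3 * 2 ^ 24 * D ^ 72 * X ^ 11 := by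
  classical
  rcases S.eq_empty_or_nonempty with rfl | ⟨l₀, hl₀⟩
  · simp
  have hq0 : 0 < q := Nat.pos_of_ne_zero hq.ne_zero
  have hY0 : 1 ≤ Y := by have := hY l₀ hl₀; omega
  set T : Finset ℤ := S.image (fun l => (d l : ℤ)) with hTdef
  have hcard : T.card = S.card := by
    refine Finset.card_image_of_injOn fun l hl l' hl' h => ?_
    simp only [Nat.cast_inj] at h
    have h1 := hdm l hl
    have h2 := hdm l' hl'
    have h3 := hLd l hl
    have hcop : IsCoprime ((d l : ℤ) ^ 2) (q : ℤ) := by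
      rw [← Nat.cast_pow, Nat.isCoprime_iff_coprime]
      have : Nat.Coprime (a + q * l) q := by simpa using ha
      exact this.coprime_dvd_left (Dvd.intro _ h1)
    have h4 : (d l : ℤ) ^ 2 ∣ (q : ℤ) * (l - l') := by
      refine ⟨m l - m l', ?_⟩
      have e1 : (d l : ℤ) ^ 2 * m l = a + q * l := by exact_mod_cast h1
      have e2 : (d l : ℤ) ^ 2 * m l' = a + q * l' := by rw [h]; exact_mod_cast h2
      linear_combination e2 - e1
    have h5 := hcop.dvd_of_dvd_mul_left h4
    have h6 := hS l hl
    have h7 := hS l' hl'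
    have h8 : L ≤ d l ^ 2 := by nlinarith
    have h8' : (L : ℤ) ≤ (d l : ℤ) ^ 2 := by exact_mod_cast h8
    have := Int.eq_zero_of_abs_lt_dvd h5 (by rw [abs_lt]; omega)
    omega
  have hm : ∀ l ∈ S, 1 ≤ m l ∧ m l ≤ X / Y ^ 2 := by
    intro l hl
    have h1 := hdm l hl
    refine ⟨Nat.pos_of_ne_zero fun h0 => ?_, ?_⟩
    · rw [h0, mul_zero] at h1
      have := Nat.mul_pos hq0 (hS l hl).1
      omega
    · rw [Nat.le_div_iff_mul_le (by positivity), mul_comm]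
      calc Y ^ 2 * m l ≤ d l ^ 2 * m l := by gcongr; exact (hY l hl).1
        _ ≤ X := by rw [h1]; exact (hn l hl).le
  have hex : ∀ t : ℤ, ∃ v : ℕ, t ∈ T → v ≤ X / Y ^ 2 ∧ (q : ℤ) ∣ v * t ^ 2 - a := by
    intro t
    by_cases ht : t ∈ T
    · obtain ⟨l, hl, rfl⟩ := Finset.mem_image.1 ht
      refine ⟨m l, fun _ => ⟨(hm l hl).2, l, ?_⟩⟩
      have e1 : (d l : ℤ) ^ 2 * m l = a + q * l := by exact_mod_cast hdm l hl
      linear_combination e1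
    · exact ⟨0, fun h => absurd h ht⟩
  choose f hf using hex
  have hZq : (2 * Y) ^ 2 ≤ q := by
    refine le_of_pow_le_pow_left₀ (n := 3) (by norm_num) (Nat.zero_le _) ?_
    calc ((2 * Y) ^ 2) ^ 3 = 64 * (Y ^ 3) ^ 2 := by ring
      _ ≤ 64 * X ^ 2 := by gcongr
      _ = q ^ 2 * (256 * L ^ 2) := by rw [hX]; ring
      _ ≤ q ^ 2 * q := by gcongr
      _ = q ^ 3 := by ring
  have hV : 1 ≤ X / Y ^ 2 := (hm l₀ hl₀).1.trans (hm l₀ hl₀).2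
  have main := card_pow_twelve_le_of_sparseRelations hq (by omega) hV hZq (T := T)
    (fun t ht => by
      obtain ⟨l, hl, rfl⟩ := Finset.mem_image.1 ht
      have := hY l hl
      omega) hD (fun t ht => (hf t ht).1)
    (sparseRelations_of_mul_sq (a := a) (by simpa [Int.gcd_natCast_natCast] using ha)
      fun t ht => (hf t ht).2)
  rw [hcard] at main
  have hVY : X / Y ^ 2 * Y ^ 2 ≤ X := Nat.div_mul_le_self _ _
  generalize X / Y ^ 2 = V at *
  generalize 8 * 6822144 ^ 3 = K at *
  calc S.card ^ 36 = (S.card ^ 12) ^ 3 := by ring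
    _ ≤ (K * V ^ 3 * D ^ 24 * (2 * Y) ^ 8) ^ 3 := by gcongr
    _ = K ^ 3 * 2 ^ 24 * D ^ 72 * ((V * Y ^ 2) ^ 9 * (Y ^ 3) ^ 2) := by ring
    _ ≤ K ^ 3 * 2 ^ 24 * D ^ 72 * (X ^ 9 * X ^ 2) := by gcongr
    _ = K ^ 3 * 2 ^ 24 * D ^ 72 * X ^ 11 := by ring

theorem card_pow_le_of_lt_cube {q a L X Y D : ℕ} (hq : Squarefree q) (ha : Nat.gcd a q = 1)
    (hL : 64 ≤ L) (hLq : 256 * L ^ 2 ≤ q) (hX : X = 2 * q * L)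
    (hD : ∀ n, 0 < n → n ≤ q ^ 2 → n.divisors.card ≤ D) (S : Finset ℕ) (d m : ℕ → ℕ)
    (hS : ∀ l ∈ S, 1 ≤ l ∧ l ≤ L) (hdm : ∀ l ∈ S, d l ^ 2 * m l = a + q * l)
    (hn : ∀ l ∈ S, a + q * l < X)
    (hY : ∀ l ∈ S, Y ≤ d l ∧ d l < 2 * Y) (hYX : X < Y ^ 3) :
    S.card ^ 36 ≤ (8 * 6822144 ^ 3) ^ 3 * 2 ^ 9 * D ^ 108 * X ^ 11 := by
  classical
  rcases S.eq_empty_or_nonempty with rfl | ⟨l₀, hl₀⟩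
  · simp
  have hq0 : 0 < q := Nat.pos_of_ne_zero hq.ne_zero
  have hY0 : 1 ≤ Y := by have := hY l₀ hl₀; omega
  have hXq : X ≤ q ^ 2 := by
    rw [hX]
    nlinarith
  have hm : ∀ l ∈ S, 1 ≤ m l ∧ m l ≤ X / Y ^ 2 := by
    intro l hl
    have h1 := hdm l hl
    refine ⟨Nat.pos_of_ne_zero fun h0 => ?_, ?_⟩
    · rw [h0, mul_zero] at h1
      have := Nat.mul_pos hq0 (hS l hl).1
      omega
    · rw [Nat.le_div_iff_mul_le (by positivity), mul_comm]
      calc Y ^ 2 * m l ≤ d l ^ 2 * m l := by gcongr; exact (hY l hl).1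
        _ ≤ X := by rw [h1]; exact (hn l hl).le
  have hdvd : ∀ l ∈ S, (q : ℤ) ∣ m l * (d l : ℤ) ^ 2 - a := by
    intro l hl
    have e1 : (d l : ℤ) ^ 2 * m l = a + q * l := by exact_mod_cast hdm l hl
    exact ⟨l, by linear_combination e1⟩
  have hdq : ∀ l ∈ S, d l < q := by
    intro l hl
    refine lt_of_pow_lt_pow_left₀ 2 (Nat.zero_le _) ?_
    calc d l ^ 2 ≤ d l ^ 2 * m l := Nat.le_mul_of_pos_right _ (hm l hl).1
      _ < X := by rw [hdm l hl]; exact hn l hl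
      _ ≤ q ^ 2 := hXq
  set T : Finset ℤ := S.image (fun l => (m l : ℤ)) with hTdef
  have hDq : q.divisors.card ≤ D := hD q hq0 (Nat.le_self_pow (by norm_num) q)
  have hcard : S.card ≤ D * T.card := by
    refine Finset.card_le_mul_card_image _ _ fun t ht => ?_
    set A := (S.filter (fun l => (m l : ℤ) = t)).image (fun l => (d l : ℤ)) with hA
    have hAcard : A.card = (S.filter (fun l => (m l : ℤ) = t)).card := by
      refine Finset.card_image_of_injOn fun l hl l' hl' h => ?_
      simp only [Nat.cast_inj] at h
      simp only [Finset.coe_filter, Set.mem_ofPred_eq] at hl hl'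
      have h1 := hdm l hl.1
      have h2 := hdm l' hl'.1
      have h3 : m l = m l' := by exact_mod_cast hl.2.trans hl'.2.symm
      rw [h, h3, h2] at h1
      exact (Nat.eq_of_mul_eq_mul_left hq0 (by omega)).symm
    rw [← hAcard]
    refine (card_le_card_divisors_of_sq_modEq hq A (fun x hx => ?_) fun x hx y hy => ?_).trans hDq
    · obtain ⟨l, hl, rfl⟩ := Finset.mem_image.1 hx
      have := hdq l (Finset.mem_filter.1 hl).1
      omega
    · obtain ⟨l, hl, rfl⟩ := Finset.mem_image.1 hx
      obtain ⟨l', hl', rfl⟩ := Finset.mem_image.1 hy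
      rw [Finset.mem_filter] at hl hl'
      have h1 := hdvd l hl.1
      have h2 := hdvd l' hl'.1
      rw [hl.2] at h1
      rw [hl'.2] at h2
      have h3 : IsCoprime (q : ℤ) t := by
        rw [← hl.2, Nat.isCoprime_iff_coprime]
        have : Nat.Coprime (a + q * l) q := by simpa using ha
        exact (this.coprime_dvd_left (Dvd.intro_left _ (hdm l hl.1))).symm
      refine h3.dvd_of_dvd_mul_left ?_
      have := dvd_sub h1 h2
      convert this using 1
      ring
  have hex : ∀ t : ℤ, ∃ v : ℕ, t ∈ T → v ≤ 2 * Y ∧ (q : ℤ) ∣ t * (v : ℤ) ^ 2 - a := by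
    intro t
    by_cases ht : t ∈ T
    · obtain ⟨l, hl, rfl⟩ := Finset.mem_image.1 ht
      exact ⟨d l, fun _ => ⟨(hY l hl).2.le, hdvd l hl⟩⟩
    · exact ⟨0, fun h => absurd h ht⟩
  choose f hf using hex
  have hZ : 1 ≤ X / Y ^ 2 := (hm l₀ hl₀).1.trans (hm l₀ hl₀).2
  have hTZ : ∀ t ∈ T, 1 ≤ t ∧ t ≤ ((X / Y ^ 2 : ℕ) : ℤ) := by
    intro t ht
    obtain ⟨l, hl, rfl⟩ := Finset.mem_image.1 ht
    exact_mod_cast hm l hl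
  have hVY : X / Y ^ 2 * Y ^ 2 ≤ X := Nat.div_mul_le_self _ _
  generalize X / Y ^ 2 = Z at *
  have hZY : Z ^ 24 * Y ^ 9 ≤ X ^ 11 := by
    refine Nat.le_of_mul_le_mul_right (c := Y ^ 39) ?_ (by positivity)
    calc Z ^ 24 * Y ^ 9 * Y ^ 39 = (Z * Y ^ 2) ^ 24 := by ring
      _ ≤ X ^ 24 := by gcongr
      _ = X ^ 11 * X ^ 13 := by ring
      _ ≤ X ^ 11 * (Y ^ 3) ^ 13 := by gcongr
      _ = X ^ 11 * Y ^ 39 := by ring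
  have hZ3 : Z ^ 3 ≤ X := by
    refine Nat.le_of_mul_le_mul_right (c := Y ^ 6) ?_ (by positivity)
    calc Z ^ 3 * Y ^ 6 = (Z * Y ^ 2) ^ 3 := by ring
      _ ≤ X ^ 3 := by gcongr
      _ = X * X ^ 2 := by ring
      _ ≤ X * (Y ^ 3) ^ 2 := by gcongr
      _ = X * Y ^ 6 := by ring
  have hZq : Z ^ 2 ≤ q := by
    refine le_of_pow_le_pow_left₀ (n := 3) (by norm_num) (Nat.zero_le _) ?_
    calc (Z ^ 2) ^ 3 = (Z ^ 3) ^ 2 := by ring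
      _ ≤ X ^ 2 := by gcongr
      _ = q ^ 2 * (4 * L ^ 2) := by rw [hX]; ring
      _ ≤ q ^ 2 * q := by gcongr; omega
      _ = q ^ 3 := by ring
  have main := card_pow_twelve_le_of_sparseRelations hq hZ (by omega) hZq (T := T) hTZ hD
    (fun t ht => (hf t ht).1)
    (sparseRelations_of_sq_mul (a := a) (by simpa [Int.gcd_natCast_natCast] using ha)
      fun t ht => (hf t ht).2)
  generalize 8 * 6822144 ^ 3 = K at *
  calc S.card ^ 36 ≤ (D * T.card) ^ 36 := by gcongr
    _ = D ^ 36 * (T.card ^ 12) ^ 3 := by ring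
    _ ≤ D ^ 36 * (K * (2 * Y) ^ 3 * D ^ 24 * Z ^ 8) ^ 3 := by gcongr
    _ = K ^ 3 * 2 ^ 9 * D ^ 108 * (Z ^ 24 * Y ^ 9) := by ring
    _ ≤ K ^ 3 * 2 ^ 9 * D ^ 108 * X ^ 11 := by gcongr

theorem sum_div_sq_le (L M : ℕ) : 4 * ∑ d ∈ Finset.Icc 2 M, L / d ^ 2 ≤ 3 * L := by
  have key : ∀ M : ℕ, 2 ≤ M →
      ∑ d ∈ Finset.Icc 2 M, (1 : ℚ) / (d : ℚ) ^ 2 ≤ 3 / 4 - 1 / M := by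
    intro M hM
    induction M, hM using Nat.le_induction with
    | base => norm_num
    | succ n hn ih =>
      rw [Finset.sum_Icc_succ_top (by omega)]
      have hn0 : (0 : ℚ) < n := by exact_mod_cast (by omega : 0 < n)
      have : (1 : ℚ) / ((n + 1 : ℕ) : ℚ) ^ 2 ≤ 1 / n - 1 / ((n + 1 : ℕ) : ℚ) := by
        push_cast
        rw [div_sub_div _ _ (by positivity) (by positivity), div_le_div_iff₀ (by positivity)
          (by positivity)]
        nlinarith
      linarith
  rcases lt_or_ge M 2 with h | h
  · rw [Finset.Icc_eq_empty (by omega)]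
    simp
  · have h1 : (∑ d ∈ Finset.Icc 2 M, ((L / d ^ 2 : ℕ) : ℚ)) ≤ L * (3 / 4) := by
      calc (∑ d ∈ Finset.Icc 2 M, ((L / d ^ 2 : ℕ) : ℚ))
          ≤ ∑ d ∈ Finset.Icc 2 M, (L : ℚ) * (1 / (d : ℚ) ^ 2) := by
            refine Finset.sum_le_sum fun d _ => ?_
            rw [mul_one_div]
            exact_mod_cast Nat.cast_div_le (α := ℚ) (m := L) (n := d ^ 2)
        _ ≤ L * (3 / 4) := by
            rw [← Finset.mul_sum]
            have := key M h
            have h2 : (0 : ℚ) ≤ 1 / M := by positivity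
            gcongr
            linarith
    have h2 : (4 : ℚ) * ∑ d ∈ Finset.Icc 2 M, ((L / d ^ 2 : ℕ) : ℚ) ≤ 3 * L := by linarith
    exact_mod_cast h2

theorem card_filter_dvd_le {q a m : ℕ} (L : ℕ) (ha : Nat.gcd a q = 1) :
    ((Finset.Icc 1 L).filter (fun l => m ∣ a + q * l)).card ≤ L / m + 1 := by
  rw [← Finset.card_range (L / m + 1)]
  refine Finset.card_le_card_of_injOn (fun l => l / m) (fun l hl => ?_) fun l hl l' hl' h => ?_
  · simp only [Finset.coe_filter, Finset.mem_Icc, Set.mem_ofPred_eq] at hl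
    simp only [Finset.coe_range, Set.mem_Iio]
    exact Nat.lt_succ_of_le (Nat.div_le_div_right hl.1.2)
  · simp only [Finset.coe_filter, Finset.mem_Icc, Set.mem_ofPred_eq] at hl hl' h
    have hcop : Nat.Coprime m q := by
      have : Nat.Coprime (a + q * l) q := by simpa using ha
      exact this.coprime_dvd_left hl.2
    have h1 : a + q * l ≡ a + q * l' [MOD m] :=
      (Nat.modEq_zero_iff_dvd.2 hl.2).trans (Nat.modEq_zero_iff_dvd.2 hl'.2).symm
    have h2 : l % m = l' % m :=
      Nat.ModEq.cancel_left_of_coprime hcop (Nat.ModEq.add_left_cancel' a h1)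
    rw [← Nat.div_add_mod l m, ← Nat.div_add_mod l' m, h, h2]

theorem pow_le_of_forall_not_squarefree {q a L D : ℕ} (hq : Squarefree q) (ha : Nat.gcd a q = 1)
    (haq : a < q) (hL : 64 ≤ L) (hLq : 256 * L ^ 2 ≤ q)
    (hD : ∀ n, 0 < n → n ≤ q ^ 2 → n.divisors.card ≤ D)
    (hns : ∀ l, 1 ≤ l → l ≤ L → ¬ Squarefree (a + q * l)) :
    L ^ 25 ≤ 8 ^ 36 * ((8 * 6822144 ^ 3) ^ 3 * 2 ^ 24) * 2 ^ 11 * D ^ 144 * q ^ 11 := by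
  classical
  have hq0 : 0 < q := Nat.pos_of_ne_zero hq.ne_zero
  set X := 2 * q * L with hX
  have hn : ∀ l, 1 ≤ l → l ≤ L → a + q * l < X := by
    intro l h1 h2
    rw [hX]
    nlinarith
  have hXq : X ≤ q ^ 2 := by nlinarith
  have hX0 : 0 < X := by positivity
  have hex : ∀ l, ∃ d m : ℕ, 1 ≤ l → l ≤ L → 2 ≤ d ∧ d ^ 2 * m = a + q * l := by
    intro l
    by_cases hl : 1 ≤ l ∧ l ≤ L
    · have h1 := hns l hl.1 hl.2
      rw [Nat.squarefree_iff_prime_squarefree] at h1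
      push Not at h1
      obtain ⟨p, hp, m, hm⟩ := h1
      exact ⟨p, m, fun _ _ => ⟨hp.two_le, by rw [hm, sq]⟩⟩
    · exact ⟨0, 0, fun h1 h2 => absurd ⟨h1, h2⟩ hl⟩
  choose d m hdm using hex
  set R := (Finset.Icc 1 L).filter (fun l => L < 8 * d l) with hR
  have hbad : 8 * ((Finset.Icc 1 L).filter (fun l => ¬ L < 8 * d l)).card ≤ 7 * L := by
    have hsub : (Finset.Icc 1 L).filter (fun l => ¬ L < 8 * d l) ⊆
        (Finset.Icc 2 (L / 8)).biUnion
          (fun e => (Finset.Icc 1 L).filter (fun l => e ^ 2 ∣ a + q * l)) := by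
      intro l hl
      rw [Finset.mem_filter, Finset.mem_Icc] at hl
      have h1 := hdm l hl.1.1 hl.1.2
      rw [Finset.mem_biUnion]
      exact ⟨d l, Finset.mem_Icc.2 ⟨h1.1, by omega⟩, Finset.mem_filter.2
        ⟨Finset.mem_Icc.2 hl.1, Dvd.intro _ h1.2⟩⟩
    have h1 := (Finset.card_le_card hsub).trans Finset.card_biUnion_le
    have h2 : ∑ e ∈ Finset.Icc 2 (L / 8),
        ((Finset.Icc 1 L).filter (fun l => e ^ 2 ∣ a + q * l)).card
        ≤ ∑ e ∈ Finset.Icc 2 (L / 8), (L / e ^ 2 + 1) := by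
      refine Finset.sum_le_sum fun e _ => card_filter_dvd_le L ha
    rw [Finset.sum_add_distrib, Finset.sum_const, Nat.card_Icc, smul_eq_mul, mul_one] at h2
    have h3 := sum_div_sq_le L (L / 8)
    omega
  have hRcard : L ≤ 8 * R.card := by
    have : R.card + ((Finset.Icc 1 L).filter (fun l => ¬ L < 8 * d l)).card
        = (Finset.Icc 1 L).card :=
      Finset.card_filter_add_card_filter_not (s := Finset.Icc 1 L) (fun l => L < 8 * d l)
    rw [Nat.card_Icc, Nat.add_sub_cancel] at this
    omega
  have hRmem : ∀ l ∈ R, (1 ≤ l ∧ l ≤ L) ∧ L < 8 * d l := fun l hl => by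
    rwa [hR, Finset.mem_filter, Finset.mem_Icc] at hl
  set E := Nat.log 2 X + 1 with hE
  have hED : E ≤ D := by
    have h1 := hD (2 ^ Nat.log 2 X) (by positivity)
      ((Nat.pow_log_le_self 2 hX0.ne').trans hXq)
    rw [Nat.divisors_prime_pow Nat.prime_two, Finset.card_map, Finset.card_range] at h1
    exact h1
  have hclass : ∀ i, (R.filter (fun l => Nat.log 2 (d l) = i)).card ^ 36
      ≤ (8 * 6822144 ^ 3) ^ 3 * 2 ^ 24 * D ^ 108 * X ^ 11 := by
    intro i
    have hD1 : 1 ≤ D := le_trans (by omega) hED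
    have hSm : ∀ l ∈ R.filter (fun l => Nat.log 2 (d l) = i), l ∈ R ∧ Nat.log 2 (d l) = i :=
      fun l hl => Finset.mem_filter.1 hl
    have hY : ∀ l ∈ R.filter (fun l => Nat.log 2 (d l) = i), 2 ^ i ≤ d l ∧ d l < 2 * 2 ^ i := by
      intro l hl
      obtain ⟨h1, rfl⟩ := hSm l hl
      have h2 := hdm l (hRmem l h1).1.1 (hRmem l h1).1.2
      refine ⟨Nat.pow_log_le_self 2 (by omega), ?_⟩
      rw [← pow_succ']
      exact Nat.lt_pow_succ_log_self (by norm_num) _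
    have hS := fun l hl => (hRmem l (hSm l hl).1).1
    have hdm' := fun l hl => (hdm l (hS l hl).1 (hS l hl).2).2
    have hn' := fun l hl => hn l (hS l hl).1 (hS l hl).2
    rcases le_or_gt ((2 ^ i) ^ 3) X with h | h
    · refine (card_pow_le_of_cube_le hq ha hL hLq hX hD _ d m hS hdm' hn' hY
        (fun l hl => (hRmem l (hSm l hl).1).2) h).trans ?_
      have : D ^ 72 ≤ D ^ 108 := Nat.pow_le_pow_right hD1 (by norm_num)
      gcongr
    · refine (card_pow_le_of_lt_cube hq ha hL hLq hX hD _ d m hS hdm' hn' hY h).trans ?_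
      gcongr
      · norm_num
      · norm_num
  have hmaps : ∀ l ∈ R, Nat.log 2 (d l) ∈ Finset.range E := by
    intro l hl
    have h1 := hRmem l hl
    have h2 := hdm l h1.1.1 h1.1.2
    rw [Finset.mem_range, hE, Nat.lt_succ_iff]
    refine Nat.log_mono_right ?_
    have h3 : 0 < m l := Nat.pos_of_ne_zero fun h0 => by
      have := Nat.mul_pos hq0 h1.1.1
      rw [h0] at h2
      omega
    calc d l ≤ d l ^ 2 := Nat.le_self_pow (by norm_num) _
      _ ≤ d l ^ 2 * m l := Nat.le_mul_of_pos_right _ h3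
      _ ≤ X := by rw [h2.2]; exact (hn l h1.1.1 h1.1.2).le
  obtain ⟨i, -, hi⟩ := Finset.exists_max_image (Finset.range E)
    (fun i => (R.filter (fun l => Nat.log 2 (d l) = i)).card) ⟨0, by simp [hE]⟩
  have hRi := Finset.card_le_mul_card_image_of_maps_to hmaps _ hi
  rw [Finset.card_range] at hRi
  have hc := hclass i
  generalize (R.filter (fun l => Nat.log 2 (d l) = i)).card = N at *
  generalize 8 * 6822144 ^ 3 = K at *
  have h1 : L ≤ 8 * (N * D) := hRcard.trans (by gcongr; exact hRi.trans (by gcongr))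
  refine Nat.le_of_mul_le_mul_right (c := L ^ 11) ?_ (by positivity)
  calc L ^ 25 * L ^ 11 = L ^ 36 := by ring
    _ ≤ (8 * (N * D)) ^ 36 := by gcongr
    _ = 8 ^ 36 * D ^ 36 * N ^ 36 := by ring
    _ ≤ 8 ^ 36 * D ^ 36 * (K ^ 3 * 2 ^ 24 * D ^ 108 * X ^ 11) := by gcongr
    _ = 8 ^ 36 * (K ^ 3 * 2 ^ 24) * 2 ^ 11 * D ^ 144 * q ^ 11 * L ^ 11 := by rw [hX]; ring

open Filter in
/-- For large squarefree `q`, every reduced class modulo `q` contains a squarefree integer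
`a + q l` with `1 ≤ l ≤ q ^ (11 / 25 + η)`. -/
theorem exists_forall_exists_squarefree {η : ℝ} (hη : 0 < η) (hη' : η ≤ 1 / 100) :
    ∃ Q₀ : ℕ, ∀ q : ℕ, Q₀ ≤ q → Squarefree q → ∀ a : ℕ, a < q → Nat.gcd a q = 1 →
      ∃ l : ℕ, 1 ≤ l ∧ (l : ℝ) ≤ (q : ℝ) ^ (11 / 25 + η) ∧ Squarefree (a + q * l) := by
  obtain ⟨K, hK1, hK⟩ := exists_card_divisors_le_rpow (ε := 5 * η / 288) (by positivity)
  set κ : ℝ := 8 ^ 36 * ((8 * 6822144 ^ 3) ^ 3 * 2 ^ 24) * 2 ^ 11 with hκ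
  have ht : ∀ s : ℝ, 0 < s → Tendsto (fun q : ℕ => (q : ℝ) ^ s) atTop atTop := fun s hs =>
    (tendsto_rpow_atTop hs).comp tendsto_natCast_atTop_atTop
  obtain ⟨Q₀, hQ₀⟩ := eventually_atTop.1 <|
    ((ht (20 * η) (by positivity)).eventually_gt_atTop (2 ^ 25 * κ * K ^ 144)).and <|
    ((ht (11 / 25 + η) (by positivity)).eventually_ge_atTop 64).and <|
    ((ht (1 / 10) (by norm_num)).eventually_ge_atTop 256).and (eventually_ge_atTop 1)
  refine ⟨Q₀, fun q hqQ hq a haq ha => ?_⟩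
  obtain ⟨h1, h2, h3, h4⟩ := hQ₀ q hqQ
  have hq1 : (1 : ℝ) ≤ q := by exact_mod_cast h4
  have hq0 : (0 : ℝ) < q := by linarith
  set y : ℝ := (q : ℝ) ^ (11 / 25 + η) with hy
  have hy0 : 0 ≤ y := by positivity
  set L := ⌊y⌋₊ with hLdef
  have hLy : (L : ℝ) ≤ y := Nat.floor_le hy0
  have hL64 : 64 ≤ L := Nat.le_floor (by exact_mod_cast h2)
  have hyL : y ≤ 2 * L := by
    have := Nat.lt_floor_add_one y
    have h64 : (64 : ℝ) ≤ L := by exact_mod_cast hL64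
    rw [← hLdef] at this
    linarith
  by_contra! hcon
  set D := ⌊K * (q : ℝ) ^ (2 * (5 * η / 288))⌋₊ with hDdef
  have hDle : (D : ℝ) ≤ K * (q : ℝ) ^ (2 * (5 * η / 288)) := Nat.floor_le (by positivity)
  have hD : ∀ n, 0 < n → n ≤ q ^ 2 → n.divisors.card ≤ D := by
    intro n hn hnq
    refine Nat.le_floor ((hK n hn).trans ?_)
    rw [Real.rpow_mul hq0.le, Real.rpow_two]
    gcongr
    exact_mod_cast hnq
  have hLq : 256 * L ^ 2 ≤ q := by
    have : (256 : ℝ) * (L : ℝ) ^ 2 ≤ q := by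
      calc (256 : ℝ) * (L : ℝ) ^ 2 ≤ (q : ℝ) ^ (1 / 10 : ℝ) * y ^ 2 := by gcongr
        _ = (q : ℝ) ^ (1 / 10 + (11 / 25 + η) * 2) := by
            rw [hy, ← Real.rpow_two, ← Real.rpow_mul hq0.le, ← Real.rpow_add hq0]
        _ ≤ (q : ℝ) ^ (1 : ℝ) := Real.rpow_le_rpow_of_exponent_le hq1 (by linarith)
        _ = q := Real.rpow_one _
    exact_mod_cast this
  have main := pow_le_of_forall_not_squarefree hq ha haq hL64 hLq hD fun l hl1 hlL =>
    hcon l hl1 (le_trans (by exact_mod_cast hlL) hLy)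
  have main' : (L : ℝ) ^ 25 ≤ κ * (D : ℝ) ^ 144 * (q : ℝ) ^ 11 := by
    rw [hκ]
    exact_mod_cast main
  have hfin : (q : ℝ) ^ (20 * η) * (q : ℝ) ^ (11 + 5 * η)
      ≤ 2 ^ 25 * κ * K ^ 144 * (q : ℝ) ^ (11 + 5 * η) := by
    calc (q : ℝ) ^ (20 * η) * (q : ℝ) ^ (11 + 5 * η) = y ^ 25 := by
          rw [hy, ← Real.rpow_natCast, ← Real.rpow_mul hq0.le, ← Real.rpow_add hq0]
          congr 1
          push_cast
          ring
      _ ≤ (2 * L) ^ 25 := by gcongr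
      _ = 2 ^ 25 * (L : ℝ) ^ 25 := by ring
      _ ≤ 2 ^ 25 * (κ * (K * (q : ℝ) ^ (2 * (5 * η / 288))) ^ 144 * (q : ℝ) ^ 11) := by
          refine mul_le_mul_of_nonneg_left (main'.trans ?_) (by positivity)
          gcongr
      _ = 2 ^ 25 * κ * K ^ 144 * (q : ℝ) ^ (11 + 5 * η) := by
          have : ((q : ℝ) ^ (2 * (5 * η / 288))) ^ 144 * (q : ℝ) ^ 11 = (q : ℝ) ^ (11 + 5 * η) := by
            rw [← Real.rpow_natCast, ← Real.rpow_natCast, ← Real.rpow_mul hq0.le,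
              ← Real.rpow_add hq0]
            congr 1
            push_cast
            ring
          rw [← this]
          ring
  have := le_of_mul_le_mul_right hfin (by positivity)
  linarith

/-- For every ε > 0 there is C = C(ε) such that for every squarefree q and every a
coprime to q, the least positive squarefree integer congruent to a modulo q is at most
C · q^(36/25 + ε). -/
theorem least_squarefree_in_AP :
    ∀ ε : ℝ, 0 < ε → ∃ C : ℝ, 0 < C ∧
      ∀ q : ℕ, Squarefree q → ∀ a : ℤ, Int.gcd a q = 1 →
        ((sInf {n : ℕ | 0 < n ∧ Squarefree n ∧ (n : ZMod q) = (a : ZMod q)} : ℕ) : ℝ)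
          ≤ C * (q : ℝ) ^ ((36 / 25 : ℝ) + ε) := by
  intro ε hε
  obtain ⟨Q₀, hQ₀⟩ := exists_forall_exists_squarefree (η := min ε (1 / 100))
    (lt_min hε (by norm_num)) (min_le_right _ _)
  let F : ℕ → ℕ → ℕ := fun q r =>
    sInf {n : ℕ | 0 < n ∧ Squarefree n ∧ (n : ZMod q) = (r : ZMod q)}
  set M : ℕ := ∑ q ∈ Finset.range Q₀, ∑ r ∈ Finset.range q, F q r with hM
  refine ⟨M + 2, by positivity, fun q hq a ha => ?_⟩
  have hq0 : 0 < q := Nat.pos_of_ne_zero hq.ne_zero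
  have hq1 : (1 : ℝ) ≤ q := by exact_mod_cast hq0
  obtain ⟨r, hr⟩ : ∃ r : ℕ, (r : ℤ) = a % q :=
    ⟨(a % q).toNat, Int.toNat_of_nonneg (Int.emod_nonneg _ (by omega))⟩
  have hrq : r < q := by
    have := Int.emod_lt_of_pos a (by exact_mod_cast hq0 : (0 : ℤ) < q)
    omega
  have hra : (a : ZMod q) = (r : ZMod q) := by
    have : ((r : ℤ) : ZMod q) = (a : ZMod q) := by rw [hr, ZMod.intCast_mod]
    rw [← this, Int.cast_natCast]
  rw [hra]
  have hpow : (1 : ℝ) ≤ (q : ℝ) ^ ((36 / 25 : ℝ) + ε) := Real.one_le_rpow hq1 (by positivity)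
  rcases lt_or_ge q Q₀ with hlt | hge
  · have h1 : F q r ≤ M :=
      (Finset.single_le_sum (f := F q) (fun _ _ => Nat.zero_le _) (Finset.mem_range.2 hrq)).trans
        (Finset.single_le_sum (f := fun q => ∑ r ∈ Finset.range q, F q r)
          (fun _ _ => Nat.zero_le _) (Finset.mem_range.2 hlt))
    calc ((F q r : ℕ) : ℝ) ≤ (M : ℝ) := by exact_mod_cast h1
      _ ≤ (M + 2) * 1 := by linarith
      _ ≤ (M + 2) * (q : ℝ) ^ ((36 / 25 : ℝ) + ε) := by gcongr
  · have hgcd : Nat.gcd r q = 1 := by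
      rw [← Int.gcd_natCast_natCast, hr, Int.gcd_emod, ha]
    obtain ⟨l, hl1, hl, hsf⟩ := hQ₀ q hge hq r hrq hgcd
    have h1 : F q r ≤ r + q * l :=
      Nat.sInf_le ⟨by positivity, hsf, by simp⟩
    have h2 : r + q * l ≤ 2 * (q * l) := by nlinarith
    calc ((F q r : ℕ) : ℝ) ≤ 2 * (q * l) := by exact_mod_cast h1.trans h2
      _ ≤ 2 * ((q : ℝ) ^ (1 : ℝ) * (q : ℝ) ^ (11 / 25 + min ε (1 / 100))) := by
          rw [Real.rpow_one]
          gcongr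
      _ = 2 * (q : ℝ) ^ (1 + (11 / 25 + min ε (1 / 100))) := by
          rw [← Real.rpow_add (by linarith)]
      _ ≤ 2 * (q : ℝ) ^ ((36 / 25 : ℝ) + ε) := by
          refine mul_le_mul_of_nonneg_left (Real.rpow_le_rpow_of_exponent_le hq1 ?_) zero_le_two
          linarith [min_le_left ε (1 / 100)]
      _ ≤ (M + 2) * (q : ℝ) ^ ((36 / 25 : ℝ) + ε) := by
          gcongr
          linarith [Nat.cast_nonneg (α := ℝ) M]
end

section
/- For every ε > 0 there is a constant C = C(ε) such that for every squarefree positive integer q, every unit a of Z/qZ, and all real numbers M, N with 1 ≤ M ≤ q^(3/4) and 1 ≤ N < q/2, the number of pairs (m, n) of positive integers with m ≤ M, n ≤ N, gcd(n,q) = 1 and m·n² ≡ a (mod q) is at most C · M^(2/3) · N^(1/4) · q^ε. -/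
open Finset

theorem exists_pow_card_primeFactors_le (A : ℕ) {ε : ℝ} (hε : 0 < ε) :
    ∃ C : ℝ, 1 ≤ C ∧ ∀ n : ℕ, n ≠ 0 → (A : ℝ) ^ n.primeFactors.card ≤ C * (n : ℝ) ^ ε := by
  rcases Nat.eq_zero_or_pos A with rfl | hA
  · refine ⟨1, le_rfl, fun n hn => ?_⟩
    have h1 : (1 : ℝ) ≤ n := by exact_mod_cast Nat.one_le_iff_ne_zero.2 hn
    have h2 := Real.one_le_rpow h1 hε.le
    rw [one_mul]
    refine le_trans ?_ h2
    exact_mod_cast pow_le_one₀ (by norm_num) (by norm_num)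
  have hA1 : (1 : ℝ) ≤ A := by exact_mod_cast hA
  obtain ⟨B, hB⟩ := exists_nat_ge ((A : ℝ) ^ (1 / ε))
  refine ⟨(A : ℝ) ^ B, one_le_pow₀ hA1, fun n hn => ?_⟩
  have hsplit := card_filter_add_card_filter_not (s := n.primeFactors) (fun p => p < B)
  rw [← hsplit, pow_add]
  refine mul_le_mul ?_ ?_ (by positivity) (by positivity)
  · refine pow_le_pow_right₀ hA1 ?_
    calc _ ≤ (range B).card := card_le_card fun p hp => by
          simp only [mem_filter] at hp; exact mem_range.2 hp.2
      _ = B := card_range B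
  · have h1 : ∀ p ∈ n.primeFactors.filter (fun p => ¬ p < B), (A : ℝ) ≤ (p : ℝ) ^ ε := by
      intro p hp
      simp only [mem_filter, not_lt] at hp
      have h2 : (A : ℝ) ^ (1 / ε) ≤ p := hB.trans (by exact_mod_cast hp.2)
      have h3 := Real.rpow_le_rpow (by positivity) h2 hε.le
      rwa [← Real.rpow_mul (by positivity), one_div_mul_cancel hε.ne', Real.rpow_one] at h3
    calc (A : ℝ) ^ (n.primeFactors.filter (fun p => ¬ p < B)).card
        = ∏ p ∈ n.primeFactors.filter (fun p => ¬ p < B), (A : ℝ) := by rw [prod_const]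
      _ ≤ ∏ p ∈ n.primeFactors.filter (fun p => ¬ p < B), (p : ℝ) ^ ε :=
          prod_le_prod (fun _ _ => by positivity) h1
      _ = ((∏ p ∈ n.primeFactors.filter (fun p => ¬ p < B), p : ℕ) : ℝ) ^ ε := by
          rw [Real.finsetProd_rpow _ _ (fun _ _ => by positivity)]; push_cast; rfl
      _ ≤ (n : ℝ) ^ ε := by
          refine Real.rpow_le_rpow (by positivity) ?_ hε.le
          have h4 : ∏ p ∈ n.primeFactors.filter (fun p => ¬ p < B), p ≤ ∏ p ∈ n.primeFactors, p :=
            prod_le_prod_of_subset_of_one_le' (filter_subset _ _) fun p hp _ =>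
              (Nat.prime_of_mem_primeFactors hp).one_le
          exact_mod_cast h4.trans (Nat.le_of_dvd (Nat.pos_of_ne_zero hn) (Nat.prod_primeFactors_dvd n))

theorem exists_le_rpow_mul_primesLE_card {ε : ℝ} (hε : 0 < ε) :
    ∃ C : ℝ, 1 ≤ C ∧ ∀ L : ℕ, 1 ≤ L → (L : ℝ) ≤ C * (L : ℝ) ^ ε * ((Nat.primesLE L).card + 1) := by
  refine ⟨(2 / ε + 2) / Real.log 2 + 1, ?_, fun L hL => ?_⟩
  · have := Real.log_pos one_lt_two
    have : 0 ≤ (2 / ε + 2) / Real.log 2 := by positivity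
    linarith
  have hl2 := Real.log_pos one_lt_two
  have hL1 : (1 : ℝ) ≤ L := by exact_mod_cast hL
  have hp1 : 1 ≤ (L : ℝ) ^ ε := Real.one_le_rpow hL1 hε.le
  have h1 := (Chebyshev.psi_ge L).trans (Chebyshev.psi_le_primeCounting_mul_log L)
  have h2 : Real.log L ≤ (L : ℝ) ^ ε / ε := Real.log_le_rpow_div (by positivity) hε
  have h3 : Real.log ((L : ℝ) + 1) ≤ Real.log L + 1 := by
    have h4 : Real.log ((L : ℝ) + 1) ≤ Real.log (2 * L) :=
      Real.log_le_log (by positivity) (by linarith)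
    rw [Real.log_mul (by norm_num) (by positivity)] at h4
    have := Real.log_two_lt_d9
    linarith
  rw [Nat.primesLE_card_eq_primeCounting]
  set P : ℝ := (Nat.primeCounting L : ℝ)
  have hP : 0 ≤ P := Nat.cast_nonneg _
  have h5 : (L : ℝ) * Real.log 2 ≤ (P + 1) * ((2 / ε + 2) * (L : ℝ) ^ ε) := by
    have h6 : (L : ℝ) * Real.log 2 ≤ (P + 1) * (Real.log L + 1) := by
      have := Real.log_nonneg hL1
      nlinarith
    refine h6.trans (mul_le_mul_of_nonneg_left ?_ (by positivity))
    have h7 : (L : ℝ) ^ ε / ε = 1 / ε * (L : ℝ) ^ ε := by ring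
    have : 2 / ε * (L : ℝ) ^ ε = 2 * (1 / ε * (L : ℝ) ^ ε) := by ring
    have : 0 ≤ 1 / ε * (L : ℝ) ^ ε := by positivity
    nlinarith
  have h8 : (L : ℝ) ≤ (P + 1) * ((2 / ε + 2) * (L : ℝ) ^ ε) / Real.log 2 := by
    rw [le_div_iff₀ hl2]; exact h5
  calc (L : ℝ) ≤ _ := h8
    _ = (2 / ε + 2) / Real.log 2 * (L : ℝ) ^ ε * (P + 1) := by ring
    _ ≤ _ := by
      gcongr; linarith

open Polynomial in
theorem card_zmod_roots_le {q D : ℕ} [NeZero q] (hq : Squarefree q) (F : ℤ[X])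
    (hdeg : F.natDegree ≤ D)
    (hF : ∀ p : ℕ, p.Prime → p ∣ q → F.map (Int.castRingHom (ZMod p)) ≠ 0) :
    (univ.filter fun u : ZMod q => F.eval₂ (Int.castRingHom (ZMod q)) u = 0).card
      ≤ D ^ q.primeFactors.card := by
  classical
  have hpr : ∀ p : q.primeFactors, Fact (p : ℕ).Prime :=
    fun p => ⟨Nat.prime_of_mem_primeFactors p.2⟩
  have hdvd : ∀ p : q.primeFactors, (p : ℕ) ∣ q := fun p => Nat.dvd_of_mem_primeFactors p.2
  let φ : ZMod q → (p : q.primeFactors) → ZMod p := fun u p => ZMod.castHom (hdvd p) (ZMod p) u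
  let T : (p : q.primeFactors) → Finset (ZMod p) :=
    fun p => (F.map (Int.castRingHom (ZMod p))).roots.toFinset
  calc _ ≤ (Fintype.piFinset T).card := by
        refine card_le_card_of_injOn φ ?_ ?_
        · intro u hu
          simp only [coe_filter, mem_univ, true_and, Set.mem_ofPred_eq] at hu
          simp only [mem_coe, Fintype.mem_piFinset]
          intro p
          simp only [T, Multiset.mem_toFinset]
          rw [mem_roots (hF p (hpr p).out (hdvd p)), IsRoot, eval_map]
          have := congrArg (ZMod.castHom (hdvd p) (ZMod p)) hu
          rw [hom_eval₂, map_zero] at this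
          have hc : (ZMod.castHom (hdvd p) (ZMod p)).comp (Int.castRingHom (ZMod q)) =
              Int.castRingHom (ZMod p) := RingHom.ext_int _ _
          rw [hc] at this
          exact this
        · intro u _ v _ huv
          rw [← sub_eq_zero, ← ZMod.natCast_zmod_val (u - v), ZMod.natCast_eq_zero_iff]
          suffices h : ∏ p ∈ q.primeFactors, p ∣ (u - v).val by
            rwa [Nat.prod_primeFactors_of_squarefree hq] at h
          refine Finset.prod_primes_dvd _ (fun p hp => (Nat.prime_of_mem_primeFactors hp).prime) ?_
          intro p hp
          have h1 := congrFun huv ⟨p, hp⟩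
          simp only [φ] at h1
          rw [← sub_eq_zero, ← map_sub, ← ZMod.natCast_zmod_val (u - v), map_natCast,
            ZMod.natCast_eq_zero_iff] at h1
          exact h1
    _ = ∏ p, (T p).card := Fintype.card_piFinset T
    _ ≤ ∏ _p : q.primeFactors, D := by
        refine prod_le_prod' fun p _ => ?_
        exact (Multiset.toFinset_card_le _).trans ((card_roots' _).trans
          (natDegree_map_le.trans hdeg))
    _ = D ^ q.primeFactors.card := by simp

theorem card_coprime_pairs_le {M L q : ℕ} (hq : 0 < q) (T : Finset (ℤ × ℕ))
    (hM : ∀ j ∈ T, |j.1| ≤ M) (hL : ∀ j ∈ T, 1 ≤ j.2 ∧ j.2 ≤ L)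
    (hcop : ∀ j ∈ T, IsCoprime j.1 (j.2 : ℤ))
    (hT : ∀ i ∈ T, ∀ j ∈ T, (q : ℤ) ∣ i.1 * j.2 - j.1 * i.2) :
    q * T.card ≤ 4 * (M * L) + q := by
  rcases T.eq_empty_or_nonempty with rfl | hne
  · simp
  obtain ⟨j₀, hj₀, hmax⟩ := T.exists_max_image (fun j => j.2) hne
  set B : ℤ := ((2 * (M * L) / q : ℕ) : ℤ)
  have hcard : T.card ≤ (Icc (-B) B).card := by
    refine card_le_card_of_injOn (fun j => (j.1 * j₀.2 - j₀.1 * j.2) / q) ?_ ?_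
    · intro j hj
      obtain ⟨c, hc⟩ := hT j hj j₀ hj₀
      have hq' : (q : ℤ) ≠ 0 := by exact_mod_cast hq.ne'
      simp only [hc, Int.mul_ediv_cancel_left _ hq', coe_Icc, Set.mem_Icc]
      rw [← abs_le]
      have h1 : |(q : ℤ) * c| ≤ 2 * (M * L) := by
        rw [← hc]
        calc _ ≤ |j.1 * j₀.2| + |j₀.1 * j.2| := abs_sub _ _
          _ = |j.1| * j₀.2 + |j₀.1| * j.2 := by simp [abs_mul]
          _ ≤ M * L + M * L := by
            have := hM j hj; have := hM j₀ hj₀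
            have h3 : (j.2 : ℤ) ≤ L := by exact_mod_cast (hL j hj).2
            have h4 : (j₀.2 : ℤ) ≤ L := by exact_mod_cast (hL j₀ hj₀).2
            gcongr
          _ = _ := by ring
      rw [abs_mul, Nat.abs_cast, Int.abs_eq_natAbs] at h1
      rw [Int.abs_eq_natAbs]
      have h2 : q * c.natAbs ≤ 2 * (M * L) := by exact_mod_cast h1
      have : c.natAbs ≤ 2 * (M * L) / q := by
        rw [Nat.le_div_iff_mul_le hq]; linarith
      have h3 : (c.natAbs : ℤ) ≤ B := Int.ofNat_le.2 this
      omega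
    · intro i hi j hj hij
      have hi' := hT i hi j₀ hj₀
      have hj' := hT j hj j₀ hj₀
      have heq : i.1 * (j₀.2 : ℤ) - j₀.1 * i.2 = j.1 * j₀.2 - j₀.1 * j.2 := by
        rw [← Int.ediv_mul_cancel hi', ← Int.ediv_mul_cancel hj']
        exact congrArg (· * (q : ℤ)) hij
      have hd : (j₀.2 : ℤ) ∣ (i.2 : ℤ) - j.2 := by
        refine (hcop j₀ hj₀).symm.dvd_of_dvd_mul_left ⟨i.1 - j.1, ?_⟩
        linear_combination -heq
      have h2 : i.2 = j.2 := by
        have h3 := hL i hi; have h4 := hL j hj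
        have h5 := hmax i hi; have h6 := hmax j hj
        have h7 : ((i.2 : ℤ) - j.2) = 0 := by
          refine Int.eq_zero_of_abs_lt_dvd hd ?_
          rw [abs_lt]; constructor <;> omega
        omega
      have h3 : i.1 = j.1 := by
        rw [h2] at heq
        have h4 : (j₀.2 : ℤ) ≠ 0 := by have := hL j₀ hj₀; omega
        exact mul_right_cancel₀ h4 (by linarith)
      exact Prod.ext h3 h2
  have h1 : (Icc (-B) B).card = 2 * (2 * (M * L) / q) + 1 := by
    rw [Int.card_Icc]; omega
  rw [h1] at hcard
  have h2 := Nat.div_mul_le_self (2 * (M * L)) q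
  nlinarith

/-- The polynomial obtained from the norm of `√y₁ + √y₂ + √y₃ + √y₄` by substituting for `yᵢ` the
product of the `X + kⱼ` over `j ≠ i`. -/
noncomputable def normPoly (k₁ k₂ k₃ k₄ : ℤ) : Polynomial ℤ :=
  let P₁ := Polynomial.X + Polynomial.C k₁
  let P₂ := Polynomial.X + Polynomial.C k₂
  let P₃ := Polynomial.X + Polynomial.C k₃
  let P₄ := Polynomial.X + Polynomial.C k₄
  let Y₁ := P₂ * P₃ * P₄
  let Y₂ := P₁ * P₃ * P₄
  let Y₃ := P₁ * P₂ * P₄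
  let Y₄ := P₁ * P₂ * P₃
  ((Y₁ + Y₂ - Y₃ - Y₄) ^ 2 - 4 * Y₁ * Y₂ - 4 * Y₃ * Y₄) ^ 2 - 64 * Y₁ * Y₂ * Y₃ * Y₄

theorem natDegree_normPoly_le (k₁ k₂ k₃ k₄ : ℤ) : (normPoly k₁ k₂ k₃ k₄).natDegree ≤ 12 := by
  have h3 : ∀ a b c : ℤ, ((Polynomial.X + Polynomial.C a) * (Polynomial.X + Polynomial.C b) *
      (Polynomial.X + Polynomial.C c)).natDegree ≤ 3 := by
    intro a b c
    compute_degree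
  have hnum : ∀ n : ℕ, ((n : Polynomial ℤ)).natDegree ≤ 0 := fun n => by simp
  have key : ∀ Y₁ Y₂ Y₃ Y₄ : Polynomial ℤ, Y₁.natDegree ≤ 3 → Y₂.natDegree ≤ 3 →
      Y₃.natDegree ≤ 3 → Y₄.natDegree ≤ 3 →
      (((Y₁ + Y₂ - Y₃ - Y₄) ^ 2 - 4 * Y₁ * Y₂ - 4 * Y₃ * Y₄) ^ 2 -
        64 * Y₁ * Y₂ * Y₃ * Y₄).natDegree ≤ 12 := by
    intro Y₁ Y₂ Y₃ Y₄ h₁ h₂ h₃ h₄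
    have e4 : (4 : Polynomial ℤ).natDegree ≤ 0 := hnum 4
    have e64 : (64 : Polynomial ℤ).natDegree ≤ 0 := hnum 64
    refine Polynomial.natDegree_sub_le_of_le (m := 12) (n := 12) ?_ ?_ |>.trans (by norm_num)
    · refine (Polynomial.natDegree_pow_le_of_le (m := 6) 2 ?_).trans (by norm_num)
      refine Polynomial.natDegree_sub_le_of_le (m := 6) (n := 6) ?_ ?_ |>.trans (by norm_num)
      · refine Polynomial.natDegree_sub_le_of_le (m := 6) (n := 6) ?_ ?_ |>.trans (by norm_num)
        · refine (Polynomial.natDegree_pow_le_of_le (m := 3) 2 ?_).trans (by norm_num)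
          refine (Polynomial.natDegree_sub_le_of_le (Polynomial.natDegree_sub_le_of_le
            (Polynomial.natDegree_add_le_of_le h₁ h₂) h₃) h₄).trans (by norm_num)
        · exact (Polynomial.natDegree_mul_le_of_le
            (Polynomial.natDegree_mul_le_of_le e4 h₁) h₂).trans (by norm_num)
      · exact (Polynomial.natDegree_mul_le_of_le
            (Polynomial.natDegree_mul_le_of_le e4 h₃) h₄).trans (by norm_num)
    · exact (Polynomial.natDegree_mul_le_of_le (Polynomial.natDegree_mul_le_of_le
        (Polynomial.natDegree_mul_le_of_le (Polynomial.natDegree_mul_le_of_le e64 h₁) h₂) h₃)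
          h₄).trans (by norm_num)
  exact key _ _ _ _ (h3 _ _ _) (h3 _ _ _) (h3 _ _ _) (h3 _ _ _)

theorem eval_neg_normPoly (k₁ k₂ k₃ k₄ : ℤ) : (normPoly k₁ k₂ k₃ k₄).eval (-k₁) =
    ((k₂ - k₁) * (k₃ - k₁) * (k₄ - k₁)) ^ 4 := by
  simp [normPoly]
  ring

theorem eval₂_normPoly_eq_zero {R : Type*} [CommRing R] (k₁ k₂ k₃ k₄ : ℤ) {α u l x₁ x₂ x₃ x₄ : R}
    (hα : IsUnit α) (hx : x₁ + x₂ + x₃ + x₄ = 0)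
    (h₁ : x₁ ^ 2 * (l * (u + k₁)) = α) (h₂ : x₂ ^ 2 * (l * (u + k₂)) = α)
    (h₃ : x₃ ^ 2 * (l * (u + k₃)) = α) (h₄ : x₄ ^ 2 * (l * (u + k₄)) = α) :
    (normPoly k₁ k₂ k₃ k₄).eval₂ (Int.castRingHom R) u = 0 := by
  simp only [normPoly, Polynomial.eval₂_sub, Polynomial.eval₂_add, Polynomial.eval₂_mul,
    Polynomial.eval₂_pow, Polynomial.eval₂_X, Polynomial.eval₂_C, Polynomial.eval₂_ofNat]
  simp only [eq_intCast]
  generalize (u + k₁ : R) = P₁ at *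
  generalize (u + k₂ : R) = P₂ at *
  generalize (u + k₃ : R) = P₃ at *
  generalize (u + k₄ : R) = P₄ at *
  refine (hα.pow 4).mul_left_cancel ?_
  have e₁ : α * (P₂ * P₃ * P₄) = l * (P₁ * P₂ * P₃ * P₄) * x₁ ^ 2 := by rw [← h₁]; ring
  have e₂ : α * (P₁ * P₃ * P₄) = l * (P₁ * P₂ * P₃ * P₄) * x₂ ^ 2 := by rw [← h₂]; ring
  have e₃ : α * (P₁ * P₂ * P₄) = l * (P₁ * P₂ * P₃ * P₄) * x₃ ^ 2 := by rw [← h₃]; ring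
  have e₄ : α * (P₁ * P₂ * P₃) = l * (P₁ * P₂ * P₃ * P₄) * x₄ ^ 2 := by rw [← h₄]; ring
  have key : ∀ Y₁ Y₂ Y₃ Y₄ : R, α ^ 4 * (((Y₁ + Y₂ - Y₃ - Y₄) ^ 2 - 4 * Y₁ * Y₂ - 4 * Y₃ * Y₄) ^ 2 -
      64 * Y₁ * Y₂ * Y₃ * Y₄) = (((α * Y₁ + α * Y₂ - α * Y₃ - α * Y₄) ^ 2 -
        4 * (α * Y₁) * (α * Y₂) - 4 * (α * Y₃) * (α * Y₄)) ^ 2 -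
      64 * (α * Y₁) * (α * Y₂) * (α * Y₃) * (α * Y₄)) := by intros; ring
  rw [key, e₁, e₂, e₃, e₄]
  obtain rfl : x₄ = -(x₁ + x₂ + x₃) := by linear_combination hx
  ring

/-- `α / (j + kᵢ l)`, for `i = 1, …, 4`, have square roots modulo `q` with vanishing sum. -/
def HasZeroSum (q : ℕ) (α : ZMod q) (j : ℤ × ℕ) (k₁ k₂ k₃ k₄ : ℤ) : Prop :=
  ∃ x₁ x₂ x₃ x₄ : ZMod q, x₁ + x₂ + x₃ + x₄ = 0 ∧
    x₁ ^ 2 * (j.1 + k₁ * j.2) = α ∧ x₂ ^ 2 * (j.1 + k₂ * j.2) = α ∧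
    x₃ ^ 2 * (j.1 + k₃ * j.2) = α ∧ x₄ ^ 2 * (j.1 + k₄ * j.2) = α

theorem card_hasZeroSum_le {M L q : ℕ} (hq : Squarefree q) (hMLq : M * L ≤ q) {α : ZMod q}
    (hα : IsUnit α) (T : Finset (ℤ × ℕ)) (hM : ∀ j ∈ T, |j.1| ≤ M)
    (hL : ∀ j ∈ T, 1 ≤ j.2 ∧ j.2 ≤ L) (hcop : ∀ j ∈ T, IsCoprime j.1 (j.2 : ℤ))
    (hlq : ∀ j ∈ T, Nat.Coprime j.2 q) {k₁ k₂ k₃ k₄ : ℤ}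
    (h₂ : k₂ ≠ k₁) (h₃ : k₃ ≠ k₁) (h₄ : k₄ ≠ k₁)
    (hT : ∀ j ∈ T, HasZeroSum q α j k₁ k₂ k₃ k₄) :
    T.card ≤ 5 * 12 ^ q.primeFactors.card *
      (Int.gcd q (k₂ - k₁) * Int.gcd q (k₃ - k₁) * Int.gcd q (k₄ - k₁)) := by
  classical
  have hq0 : 0 < q := Nat.pos_of_ne_zero hq.ne_zero
  set W : ℤ := (k₂ - k₁) * (k₃ - k₁) * (k₄ - k₁) with hW
  have hW0 : W ≠ 0 := by
    simp only [hW, ne_eq, mul_eq_zero, sub_eq_zero, not_or]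
    exact ⟨⟨h₂, h₃⟩, h₄⟩
  set g : ℕ := Int.gcd q W with hg
  have hg0 : 0 < g := Int.gcd_pos_of_ne_zero_right _ hW0
  have hgle : g ≤ Int.gcd q (k₂ - k₁) * Int.gcd q (k₃ - k₁) * Int.gcd q (k₄ - k₁) := by
    refine Nat.le_of_dvd ?_ ?_
    · have hq1 : (q : ℤ) ≠ 0 := by exact_mod_cast hq0.ne'
      have := fun x : ℤ => Int.gcd_pos_of_ne_zero_left x hq1
      exact Nat.mul_pos (Nat.mul_pos (this _) (this _)) (this _)
    · simp only [hg, hW, Int.gcd, Int.natAbs_mul]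
      exact (Nat.gcd_mul_right_dvd_mul_gcd _ _ _).trans
        (Nat.mul_dvd_mul_right (Nat.gcd_mul_right_dvd_mul_gcd _ _ _) _)
  obtain ⟨q', hq'⟩ : g ∣ q := Nat.gcd_dvd_left q W.natAbs
  have hq'0 : 0 < q' := Nat.pos_of_ne_zero fun h => by simp [h] at hq'; omega
  have hdvd : q' ∣ q := ⟨g, by rw [hq', mul_comm]⟩
  have hsf : Squarefree q' := hq.squarefree_of_dvd hdvd
  have hcopg : Nat.Coprime g q' := by
    rw [hq'] at hq
    exact Nat.coprime_of_squarefree_mul hq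
  have : NeZero q' := ⟨hq'0.ne'⟩
  let φ := ZMod.castHom hdvd (ZMod q')
  have hlu : ∀ j ∈ T, IsUnit (j.2 : ZMod q') := fun j hj =>
    (ZMod.isUnit_iff_coprime _ _).2 ((hlq j hj).coprime_dvd_right hdvd)
  let u : ℤ × ℕ → ZMod q' := fun j => j.1 * (j.2 : ZMod q')⁻¹
  have hu : ∀ j ∈ T, (j.2 : ZMod q') * u j = j.1 := by
    intro j hj
    simp only [u]
    rw [mul_left_comm, ZMod.mul_inv_of_unit _ (hlu j hj), mul_one]
  let Z := univ.filter fun u : ZMod q' =>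
    (normPoly k₁ k₂ k₃ k₄).eval₂ (Int.castRingHom (ZMod q')) u = 0
  have hZ : Z.card ≤ 12 ^ q'.primeFactors.card := by
    refine card_zmod_roots_le hsf _ (natDegree_normPoly_le _ _ _ _) fun p hp hpq h0 => ?_
    have h1 := congrArg (Polynomial.eval (Int.castRingHom (ZMod p) (-k₁))) h0
    rw [Polynomial.eval_map, Polynomial.eval₂_hom, eval_neg_normPoly, Polynomial.eval_zero,
      eq_intCast, ZMod.intCast_zmod_eq_zero_iff_dvd] at h1
    have h2 : (p : ℤ) ∣ W := (Nat.prime_iff_prime_int.1 hp).dvd_of_dvd_pow h1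
    have h3 : p ∣ g := Nat.dvd_gcd (by simpa using hpq.trans hdvd) (Int.natCast_dvd.1 h2)
    exact hp.one_lt.ne' (Nat.dvd_one.1 (hcopg ▸ Nat.dvd_gcd h3 hpq))
  have hmaps : ∀ j ∈ T, u j ∈ Z := by
    intro j hj
    obtain ⟨x₁, x₂, x₃, x₄, hx, e₁, e₂, e₃, e₄⟩ := hT j hj
    have hk : ∀ (x : ZMod q) (k : ℤ), x ^ 2 * (j.1 + k * j.2) = α →
        φ x ^ 2 * ((j.2 : ZMod q') * (u j + k)) = φ α := by
      intro x k h
      rw [mul_add, hu j hj, ← h]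
      simp only [map_mul, map_pow, map_add, map_intCast, map_natCast]
      ring
    simp only [Z, mem_filter, mem_univ, true_and]
    refine eval₂_normPoly_eq_zero _ _ _ _ (hα.map φ) ?_ (hk _ _ e₁) (hk _ _ e₂) (hk _ _ e₃)
      (hk _ _ e₄)
    rw [← map_add, ← map_add, ← map_add, hx, map_zero]
  have hfib : ∀ z ∈ Z, (T.filter fun j => u j = z).card ≤ 5 * g := by
    intro z _
    have h1 := card_coprime_pairs_le hq'0 (T.filter fun j => u j = z)
      (fun j hj => hM j (mem_filter.1 hj).1) (fun j hj => hL j (mem_filter.1 hj).1)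
      (fun j hj => hcop j (mem_filter.1 hj).1) (by
        intro i hi j hj
        obtain ⟨hi, hiz⟩ := mem_filter.1 hi
        obtain ⟨hj, hjz⟩ := mem_filter.1 hj
        rw [← ZMod.intCast_zmod_eq_zero_iff_dvd]
        push_cast
        rw [← hu i hi, ← hu j hj, hiz, hjz]
        ring)
    have h2 : q' * (T.filter fun j => u j = z).card ≤ q' * (5 * g) := by nlinarith
    exact Nat.le_of_mul_le_mul_left h2 hq'0
  calc T.card ≤ 5 * g * Z.card := card_le_mul_card_image_of_maps_to hmaps _ hfib
    _ ≤ 5 * g * 12 ^ q.primeFactors.card := by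
        refine Nat.mul_le_mul_left _ (hZ.trans (Nat.pow_le_pow_right (by norm_num) ?_))
        exact card_le_card (Nat.primeFactors_mono hdvd hq0.ne')
    _ = 5 * 12 ^ q.primeFactors.card * g := by ring
    _ ≤ _ := Nat.mul_le_mul_left _ hgle

theorem card_divisors_le_two_pow {q : ℕ} (hq : Squarefree q) :
    q.divisors.card ≤ 2 ^ q.primeFactors.card := by
  rw [Nat.card_divisors hq.ne_zero, ← prod_const]
  exact prod_le_prod' fun p _ => Nat.succ_le_succ (hq.natFactorization_le_one p)

/-- `gcd (q, b - a)`, replaced by `0` when `a = b`. -/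
def offDiagGcd (q : ℕ) (a b : ℤ) : ℕ := if b = a then 0 else Int.gcd q (b - a)

theorem sum_offDiagGcd_le {q : ℕ} (hq : Squarefree q) (K : ℕ) {a : ℤ} (ha : a ∈ Icc (1 : ℤ) K) :
    ∑ b ∈ Icc (1 : ℤ) K, offDiagGcd q a b ≤ 2 * K * 2 ^ q.primeFactors.card := by
  have hq0 : q ≠ 0 := hq.ne_zero
  calc ∑ b ∈ Icc (1 : ℤ) K, offDiagGcd q a b
      ≤ ∑ b ∈ Icc (1 : ℤ) K, ∑ d ∈ q.divisors, if b ≠ a ∧ (d : ℤ) ∣ b - a then d else 0 := by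
        refine sum_le_sum fun b _ => ?_
        unfold offDiagGcd
        split_ifs with h
        · exact Nat.zero_le _
        · have hm : Int.gcd q (b - a) ∈ q.divisors :=
            Nat.mem_divisors.2 ⟨Nat.gcd_dvd_left q _, hq0⟩
          refine le_trans ?_ (single_le_sum (fun _ _ => Nat.zero_le _) hm)
          rw [if_pos ⟨h, Int.gcd_dvd_right _ _⟩]
    _ = ∑ d ∈ q.divisors, d * ((Icc (1 : ℤ) K).filter fun b => b ≠ a ∧ (d : ℤ) ∣ b - a).card := by
        rw [sum_comm]
        refine sum_congr rfl fun d _ => ?_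
        rw [← sum_filter, sum_const, smul_eq_mul, mul_comm]
    _ ≤ ∑ _d ∈ q.divisors, 2 * K := by
        refine sum_le_sum fun d hd => ?_
        have hd0 : 0 < d := Nat.pos_of_mem_divisors hd
        have hcard : ((Icc (1 : ℤ) K).filter fun b => b ≠ a ∧ (d : ℤ) ∣ b - a).card ≤
            ((Icc (-((K / d : ℕ) : ℤ)) ((K / d : ℕ) : ℤ)).erase 0).card := by
          refine card_le_card_of_injOn (fun b => (b - a) / d) ?_ ?_
          · intro b hb
            obtain ⟨hb, hba, c, hc⟩ := mem_filter.1 hb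
            have hd' : (d : ℤ) ≠ 0 := by exact_mod_cast hd0.ne'
            have hc0 : c ≠ 0 := by rintro rfl; exact hba (by linarith)
            simp only [hc, Int.mul_ediv_cancel_left _ hd', mem_coe, mem_erase]
            refine ⟨hc0, mem_Icc.2 ?_⟩
            rw [mem_Icc] at ha hb
            have h1 : |(d : ℤ) * c| ≤ K := by rw [← hc, abs_le]; constructor <;> omega
            rw [abs_mul, Nat.abs_cast, Int.abs_eq_natAbs] at h1
            have h2 : d * c.natAbs ≤ K := by exact_mod_cast h1
            have h3 : c.natAbs ≤ K / d := by rw [Nat.le_div_iff_mul_le hd0]; linarith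
            omega
          · intro b hb c hc hbc
            have h1 := (mem_filter.1 hb).2.2
            have h2 := (mem_filter.1 hc).2.2
            have h3 : b - a = c - a := by
              rw [← Int.ediv_mul_cancel h1, ← Int.ediv_mul_cancel h2]
              exact congrArg (· * (d : ℤ)) hbc
            linarith
        have h0 : (0 : ℤ) ∈ Icc (-((K / d : ℕ) : ℤ)) ((K / d : ℕ) : ℤ) :=
          mem_Icc.2 ⟨neg_nonpos.2 (Int.natCast_nonneg _), Int.natCast_nonneg _⟩
        rw [card_erase_of_mem h0, Int.card_Icc] at hcard
        have h1 : ((Icc (1 : ℤ) K).filter fun b => b ≠ a ∧ (d : ℤ) ∣ b - a).card ≤ 2 * (K / d) := by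
          omega
        have h2 := Nat.div_mul_le_self K d
        nlinarith
    _ ≤ _ := by
        rw [sum_const, smul_eq_mul, mul_comm]
        exact Nat.mul_le_mul_left _ (card_divisors_le_two_pow hq)

theorem card_sq_mul_eq_le {q : ℕ} [NeZero q] (hq : Squarefree q) {α : ZMod q} (hα : IsUnit α)
    (c : ZMod q) : (univ.filter fun u : ZMod q => u ^ 2 * c = α).card ≤ 2 ^ q.primeFactors.card := by
  let F : Polynomial ℤ := Polynomial.C (c.val : ℤ) * Polynomial.X ^ 2 - Polynomial.C (α.val : ℤ)
  have hF : ∀ u : ZMod q, F.eval₂ (Int.castRingHom (ZMod q)) u = c * u ^ 2 - α := by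
    intro u
    simp only [F, Polynomial.eval₂_sub, Polynomial.eval₂_mul, Polynomial.eval₂_pow,
      Polynomial.eval₂_X, Polynomial.eval₂_C]
    simp
  have h := card_zmod_roots_le (D := 2) hq F (by simp only [F]; compute_degree) ?_
  · refine le_trans (card_le_card fun u hu => ?_) h
    simp only [mem_filter, mem_univ, true_and] at hu ⊢
    rw [hF, ← hu]; ring
  · intro p hp hpq h0
    have h1 := congrArg (Polynomial.eval 0) h0
    simp only [F, Polynomial.map_sub, Polynomial.map_mul, Polynomial.map_pow, Polynomial.map_C,
      Polynomial.map_X, Polynomial.eval_sub, Polynomial.eval_mul, Polynomial.eval_pow,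
      Polynomial.eval_X, Polynomial.eval_C, Polynomial.eval_zero] at h1
    have h1' : (α.val : ZMod p) = 0 := by simpa using h1
    have h2 : Nat.Coprime α.val q := by
      rw [← ZMod.isUnit_iff_coprime]; simpa using hα
    have h3 : p ∣ α.val := (ZMod.natCast_eq_zero_iff _ _).1 h1'
    exact hp.one_lt.ne' (Nat.dvd_one.1 (h2 ▸ Nat.dvd_gcd h3 hpq))

theorem card_filter_sq_mul_eq_le {q : ℕ} (hq : Squarefree q) {α : ZMod q} (hα : IsUnit α)
    (B : Finset ℕ) (hB : ∀ n ∈ B, n < q) (c : ZMod q) :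
    (B.filter fun n : ℕ => (n : ZMod q) ^ 2 * c = α).card ≤ 2 ^ q.primeFactors.card := by
  have : NeZero q := ⟨hq.ne_zero⟩
  refine le_trans (card_le_card_of_injOn (fun n : ℕ => (n : ZMod q)) ?_ ?_)
    (card_sq_mul_eq_le hq hα c)
  · intro n hn
    simpa using (mem_filter.1 hn).2
  · intro n hn m hm hnm
    have h1 := hB n (mem_filter.1 hn).1
    have h2 := hB m (mem_filter.1 hm).1
    exact Nat.ModEq.eq_of_lt_of_lt ((ZMod.natCast_eq_natCast_iff _ _ _).1 hnm) h1 h2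

open Classical in
theorem addEnergy_le_card_hasZeroSum {q : ℕ} (hq : Squarefree q) {α : ZMod q} (hα : IsUnit α)
    (j : ℤ × ℕ) (B : Finset ℕ) (hBq : ∀ n ∈ B, n < q) (I : Finset ℤ)
    (hB : ∀ n ∈ B, ∃ k ∈ I, (n : ZMod q) ^ 2 * (j.1 + k * j.2) = α) :
    B.addEnergy B ≤ 16 ^ q.primeFactors.card * ((I ×ˢ I ×ˢ I ×ˢ I).filter fun k =>
      HasZeroSum q α j k.1 k.2.1 k.2.2.1 k.2.2.2).card := by
  choose! κ hκI hκ using hB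
  let R : ℤ → Finset ℕ := fun k => B.filter fun n : ℕ => (n : ZMod q) ^ 2 * (j.1 + k * j.2) = α
  have hR : ∀ k, (R k).card ≤ 2 ^ q.primeFactors.card := fun k =>
    card_filter_sq_mul_eq_le hq hα B hBq _
  rw [addEnergy_eq_card_filter]
  refine card_le_mul_card_image_of_maps_to
    (f := fun x : (ℕ × ℕ) × ℕ × ℕ => (κ x.1.1, κ x.1.2, κ x.2.1, κ x.2.2)) ?_ _ ?_
  · rintro ⟨⟨a, b⟩, c, d⟩ hx
    simp only [mem_filter, mem_product] at hx ⊢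
    obtain ⟨⟨⟨ha, hb⟩, hc, hd⟩, h⟩ := hx
    refine ⟨⟨hκI a ha, hκI b hb, hκI c hc, hκI d hd⟩, a, b, -c, -d, ?_, hκ a ha, hκ b hb, ?_, ?_⟩
    · have : ((a + b : ℕ) : ZMod q) = ((c + d : ℕ) : ZMod q) := by rw [h]
      push_cast at this
      linear_combination this
    · rw [neg_sq]; exact hκ c hc
    · rw [neg_sq]; exact hκ d hd
  · rintro ⟨k₁, k₂, k₃, k₄⟩ _
    calc _ ≤ ((R k₁ ×ˢ R k₂) ×ˢ R k₃ ×ˢ R k₄).card := by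
          refine card_le_card ?_
          rintro ⟨⟨a, b⟩, c, d⟩ hx
          simp only [mem_filter, mem_product, Prod.mk.injEq, R] at hx ⊢
          obtain ⟨⟨⟨⟨ha, hb⟩, hc, hd⟩, -⟩, rfl, rfl, rfl, rfl⟩ := hx
          exact ⟨⟨⟨ha, hκ a ha⟩, hb, hκ b hb⟩, ⟨hc, hκ c hc⟩, hd, hκ d hd⟩
      _ = ((R k₁).card * (R k₂).card) * ((R k₃).card * (R k₄).card) := by simp only [card_product]
      _ ≤ (2 ^ q.primeFactors.card * 2 ^ q.primeFactors.card) *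
          (2 ^ q.primeFactors.card * 2 ^ q.primeFactors.card) := by gcongr <;> exact hR _
      _ = 16 ^ q.primeFactors.card := by
          rw [← mul_pow, ← mul_pow]; norm_num

theorem HasZeroSum.rotate {q : ℕ} {α : ZMod q} {j : ℤ × ℕ} {k₁ k₂ k₃ k₄ : ℤ}
    (h : HasZeroSum q α j k₁ k₂ k₃ k₄) : HasZeroSum q α j k₂ k₃ k₄ k₁ := by
  obtain ⟨x₁, x₂, x₃, x₄, h, h₁, h₂, h₃, h₄⟩ := h
  exact ⟨x₂, x₃, x₄, x₁, by linear_combination h, h₂, h₃, h₄, h₁⟩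

open Classical in
theorem card_filter_hasZeroSum_le {M L q : ℕ} (hq : Squarefree q) (hMLq : M * L ≤ q)
    {α : ZMod q} (hα : IsUnit α) (J : Finset (ℤ × ℕ)) (hM : ∀ j ∈ J, |j.1| ≤ M)
    (hL : ∀ j ∈ J, 1 ≤ j.2 ∧ j.2 ≤ L) (hcop : ∀ j ∈ J, IsCoprime j.1 (j.2 : ℤ))
    (hlq : ∀ j ∈ J, Nat.Coprime j.2 q) (a b c d : ℤ) :
    (J.filter fun j => HasZeroSum q α j a b c d).card ≤
      J.card * ((if a = b ∧ c = d then 1 else 0) + (if a = c ∧ b = d then 1 else 0) +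
        (if a = d ∧ b = c then 1 else 0)) +
      5 * 12 ^ q.primeFactors.card *
        (offDiagGcd q a b * offDiagGcd q a c * offDiagGcd q a d +
          offDiagGcd q b a * offDiagGcd q b c * offDiagGcd q b d +
          offDiagGcd q c a * offDiagGcd q c b * offDiagGcd q c d +
          offDiagGcd q d a * offDiagGcd q d b * offDiagGcd q d c) := by
  have hJ := card_filter_le J fun j => HasZeroSum q α j a b c d
  by_cases h1 : a = b ∧ c = d
  · rw [if_pos h1]; exact hJ.trans
      ((Nat.le_mul_of_pos_right _ (by positivity)).trans (Nat.le_add_right _ _))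
  by_cases h2 : a = c ∧ b = d
  · rw [if_pos h2]; exact hJ.trans
      ((Nat.le_mul_of_pos_right _ (by positivity)).trans (Nat.le_add_right _ _))
  by_cases h3 : a = d ∧ b = c
  · rw [if_pos h3]; exact hJ.trans
      ((Nat.le_mul_of_pos_right _ (by positivity)).trans (Nat.le_add_right _ _))
  refine le_trans ?_ (Nat.le_add_left _ _)
  have key : ∀ k₁ k₂ k₃ k₄ : ℤ, (∀ j, HasZeroSum q α j a b c d → HasZeroSum q α j k₁ k₂ k₃ k₄) →
      k₂ ≠ k₁ → k₃ ≠ k₁ → k₄ ≠ k₁ →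
      (J.filter fun j => HasZeroSum q α j a b c d).card ≤ 5 * 12 ^ q.primeFactors.card *
        (offDiagGcd q k₁ k₂ * offDiagGcd q k₁ k₃ * offDiagGcd q k₁ k₄) := by
    intro k₁ k₂ k₃ k₄ himp n2 n3 n4
    simp only [offDiagGcd, if_neg n2, if_neg n3, if_neg n4]
    exact card_hasZeroSum_le hq hMLq hα _ (fun j hj => hM j (mem_filter.1 hj).1)
      (fun j hj => hL j (mem_filter.1 hj).1) (fun j hj => hcop j (mem_filter.1 hj).1)
      (fun j hj => hlq j (mem_filter.1 hj).1) n2 n3 n4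
      (fun j hj => himp j (mem_filter.1 hj).2)
  by_cases ha : b ≠ a ∧ c ≠ a ∧ d ≠ a
  · refine (key a b c d (fun _ h => h) ha.1 ha.2.1 ha.2.2).trans (Nat.mul_le_mul_left _ ?_)
    omega
  by_cases hb : c ≠ b ∧ d ≠ b ∧ a ≠ b
  · refine (key b c d a (fun _ h => h.rotate) hb.1 hb.2.1 hb.2.2).trans (Nat.mul_le_mul_left _ ?_)
    rw [show offDiagGcd q b c * offDiagGcd q b d * offDiagGcd q b a =
      offDiagGcd q b a * offDiagGcd q b c * offDiagGcd q b d by ring]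
    omega
  by_cases hc : d ≠ c ∧ a ≠ c ∧ b ≠ c
  · refine (key c d a b (fun _ h => h.rotate.rotate) hc.1 hc.2.1 hc.2.2).trans
      (Nat.mul_le_mul_left _ ?_)
    rw [show offDiagGcd q c d * offDiagGcd q c a * offDiagGcd q c b =
      offDiagGcd q c a * offDiagGcd q c b * offDiagGcd q c d by ring]
    omega
  by_cases hd : a ≠ d ∧ b ≠ d ∧ c ≠ d
  · refine (key d a b c (fun _ h => h.rotate.rotate.rotate) hd.1 hd.2.1 hd.2.2).trans
      (Nat.mul_le_mul_left _ ?_)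
    omega
  omega

theorem sum_offDiagGcd_mul_le {q : ℕ} (hq : Squarefree q) (K : ℕ) :
    ∑ a ∈ Icc (1 : ℤ) K, ∑ b ∈ Icc (1 : ℤ) K, ∑ c ∈ Icc (1 : ℤ) K, ∑ d ∈ Icc (1 : ℤ) K,
      offDiagGcd q a b * offDiagGcd q a c * offDiagGcd q a d ≤
        K * (2 * K * 2 ^ q.primeFactors.card) ^ 3 := by
  calc _ = ∑ a ∈ Icc (1 : ℤ) K, (∑ b ∈ Icc (1 : ℤ) K, offDiagGcd q a b) ^ 3 := by
        refine sum_congr rfl fun a _ => ?_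
        simp_rw [← mul_sum, ← sum_mul, ← mul_sum, ← sum_mul]
        ring
    _ ≤ ∑ _a ∈ Icc (1 : ℤ) K, (2 * K * 2 ^ q.primeFactors.card) ^ 3 :=
        sum_le_sum fun a ha => Nat.pow_le_pow_left (sum_offDiagGcd_le hq K ha) 3
    _ = _ := by simp

open Classical in
theorem sum_addEnergy_le {M L q K : ℕ} (hq : Squarefree q) (hMLq : M * L ≤ q)
    {α : ZMod q} (hα : IsUnit α) (J : Finset (ℤ × ℕ)) (hM : ∀ j ∈ J, |j.1| ≤ M)
    (hL : ∀ j ∈ J, 1 ≤ j.2 ∧ j.2 ≤ L) (hcop : ∀ j ∈ J, IsCoprime j.1 (j.2 : ℤ))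
    (hlq : ∀ j ∈ J, Nat.Coprime j.2 q) (B : ℤ × ℕ → Finset ℕ)
    (hBq : ∀ j ∈ J, ∀ n ∈ B j, n < q)
    (hB : ∀ j ∈ J, ∀ n ∈ B j, ∃ k ∈ Icc (1 : ℤ) K, (n : ZMod q) ^ 2 * (j.1 + k * j.2) = α) :
    ∑ j ∈ J, (B j).addEnergy (B j) ≤ 16 ^ q.primeFactors.card *
      (J.card * (3 * K ^ 2) +
        5 * 12 ^ q.primeFactors.card * (4 * (K * (2 * K * 2 ^ q.primeFactors.card) ^ 3))) := by
  set I := Icc (1 : ℤ) K with hI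
  have hIK : I.card = K := by simp [hI]
  calc ∑ j ∈ J, (B j).addEnergy (B j)
      ≤ ∑ j ∈ J, 16 ^ q.primeFactors.card * ((I ×ˢ I ×ˢ I ×ˢ I).filter fun k =>
          HasZeroSum q α j k.1 k.2.1 k.2.2.1 k.2.2.2).card :=
        sum_le_sum fun j hj => addEnergy_le_card_hasZeroSum hq hα j _ (hBq j hj) _ (hB j hj)
    _ = 16 ^ q.primeFactors.card * ∑ a ∈ I, ∑ b ∈ I, ∑ c ∈ I, ∑ d ∈ I,
          (J.filter fun j => HasZeroSum q α j a b c d).card := by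
        rw [← mul_sum]
        congr 1
        simp_rw [card_filter]
        rw [sum_comm]
        simp_rw [sum_product]
    _ ≤ 16 ^ q.primeFactors.card * ∑ a ∈ I, ∑ b ∈ I, ∑ c ∈ I, ∑ d ∈ I,
          (J.card * ((if a = b ∧ c = d then 1 else 0) + (if a = c ∧ b = d then 1 else 0) +
            (if a = d ∧ b = c then 1 else 0)) +
          5 * 12 ^ q.primeFactors.card *
            (offDiagGcd q a b * offDiagGcd q a c * offDiagGcd q a d +
              offDiagGcd q b a * offDiagGcd q b c * offDiagGcd q b d +
              offDiagGcd q c a * offDiagGcd q c b * offDiagGcd q c d +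
              offDiagGcd q d a * offDiagGcd q d b * offDiagGcd q d c)) := by
        gcongr with a _ b _ c _ d _
        exact card_filter_hasZeroSum_le hq hMLq hα J hM hL hcop hlq a b c d
    _ ≤ _ := by
        refine Nat.mul_le_mul_left _ ?_
        simp_rw [sum_add_distrib, ← mul_sum, sum_add_distrib]
        have p1 : ∑ a ∈ I, ∑ b ∈ I, ∑ c ∈ I, ∑ d ∈ I, (if a = b ∧ c = d then 1 else 0) = K ^ 2 := by
          simp [ite_and, hIK, sq]
        have p2 : ∑ a ∈ I, ∑ b ∈ I, ∑ c ∈ I, ∑ d ∈ I, (if a = c ∧ b = d then 1 else 0) = K ^ 2 := by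
          simp [ite_and, hIK, sq]
        have p3 : ∑ a ∈ I, ∑ b ∈ I, ∑ c ∈ I, ∑ d ∈ I, (if a = d ∧ b = c then 1 else 0) = K ^ 2 := by
          simp [ite_and, hIK, sq]
        have g1 := sum_offDiagGcd_mul_le hq K
        rw [← hI] at g1
        have g2 : ∑ a ∈ I, ∑ b ∈ I, ∑ c ∈ I, ∑ d ∈ I,
            offDiagGcd q b a * offDiagGcd q b c * offDiagGcd q b d ≤
              K * (2 * K * 2 ^ q.primeFactors.card) ^ 3 := by
          rw [sum_comm]; exact g1
        have g3 : ∑ a ∈ I, ∑ b ∈ I, ∑ c ∈ I, ∑ d ∈ I,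
            offDiagGcd q c a * offDiagGcd q c b * offDiagGcd q c d ≤
              K * (2 * K * 2 ^ q.primeFactors.card) ^ 3 := by
          refine le_of_eq_of_le ?_ g1
          rw [sum_congr rfl fun a _ => sum_comm, sum_comm]
        have g4 : ∑ a ∈ I, ∑ b ∈ I, ∑ c ∈ I, ∑ d ∈ I,
            offDiagGcd q d a * offDiagGcd q d b * offDiagGcd q d c ≤
              K * (2 * K * 2 ^ q.primeFactors.card) ^ 3 := by
          refine le_of_eq_of_le ?_ g1
          rw [sum_congr rfl fun a _ => sum_congr rfl fun b _ => sum_comm,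
            sum_congr rfl fun a _ => sum_comm, sum_comm]
        rw [p1, p2, p3]
        gcongr ?_ + _ * ?_
        · exact le_of_eq (by ring)
        · linarith

theorem sum_card_pow_four_le {ι : Type*} (J : Finset ι) (N : ℕ) (B : ι → Finset ℕ)
    (hB : ∀ j ∈ J, ∀ n ∈ B j, n ∈ Icc 1 N) :
    (∑ j ∈ J, (B j).card) ^ 4 ≤ J.card ^ 3 * (2 * N * ∑ j ∈ J, (B j).addEnergy (B j)) := by
  have h1 : (∑ j ∈ J, (B j).card) ^ 2 ≤ J.card * ∑ j ∈ J, (B j).card ^ 2 :=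
    sq_sum_le_card_mul_sum_sq
  have h2 : (∑ j ∈ J, (B j).card ^ 2) ^ 2 ≤ J.card * ∑ j ∈ J, ((B j).card ^ 2) ^ 2 :=
    sq_sum_le_card_mul_sum_sq
  have h3 : ∀ j ∈ J, ((B j).card ^ 2) ^ 2 ≤ 2 * N * (B j).addEnergy (B j) := by
    intro j hj
    have h := card_sq_le_card_mul_addEnergy (B j) (B j) (Icc 1 (2 * N))
    rw [filter_true_of_mem, card_product, Nat.card_Icc, Nat.add_sub_cancel] at h
    · rwa [sq (B j).card]
    · intro x hx
      have hx1 := mem_Icc.1 (hB j hj _ (mem_product.1 hx).1)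
      have hx2 := mem_Icc.1 (hB j hj _ (mem_product.1 hx).2)
      rw [mem_Icc]; omega
  calc (∑ j ∈ J, (B j).card) ^ 4 = ((∑ j ∈ J, (B j).card) ^ 2) ^ 2 := by ring
    _ ≤ (J.card * ∑ j ∈ J, (B j).card ^ 2) ^ 2 := Nat.pow_le_pow_left h1 2
    _ = J.card ^ 2 * (∑ j ∈ J, (B j).card ^ 2) ^ 2 := by ring
    _ ≤ J.card ^ 2 * (J.card * ∑ j ∈ J, 2 * N * (B j).addEnergy (B j)) := by
        gcongr
        exact h2.trans (Nat.mul_le_mul_left _ (sum_le_sum h3))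
    _ = _ := by rw [← mul_sum]; ring

theorem card_solutions_pow_four_mul_le {q L M N R : ℕ} (hq : Squarefree q) {α : ZMod q}
    (hα : IsUnit α) (hL : 1 ≤ L) (hLM : L ^ 3 ≤ M) (hML : M ≤ 8 * L ^ 3) (hMLq : M * L ≤ q)
    (S : Finset ℕ) (hS : ∀ n ∈ S, n ∈ Icc 1 N) (hSq : ∀ n ∈ S, n < q) (μ : ℕ → ℕ)
    (hμ : ∀ n ∈ S, μ n ∈ Icc 1 M) (hsol : ∀ n ∈ S, (n : ZMod q) ^ 2 * (μ n : ZMod q) = α)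
    (hR : ∀ n ∈ S, R ≤ ((Nat.primesLE L).filter fun l => ¬ l ∣ q ∧ ¬ l ∣ μ n).card) :
    (S.card * R) ^ 4 ≤ 6414336 * 1536 ^ q.primeFactors.card * N * L ^ 12 := by
  classical
  set ω := q.primeFactors.card
  let P := (Nat.primesLE L).filter fun l => ¬ l ∣ q
  have hP : ∀ l ∈ P, l ≤ L ∧ l.Prime ∧ ¬ l ∣ q := fun l hl => by
    obtain ⟨h1, h2⟩ := mem_filter.1 hl
    rw [Nat.mem_primesLE] at h1
    exact ⟨h1.1, h1.2, h2⟩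
  let J := (Icc (-(M : ℤ)) M ×ˢ P).filter fun j => IsCoprime j.1 (j.2 : ℤ)
  have hJ : ∀ j ∈ J, |j.1| ≤ M ∧ j.2 ∈ P ∧ IsCoprime j.1 (j.2 : ℤ) := fun j hj => by
    obtain ⟨h1, h2⟩ := mem_filter.1 hj
    rw [mem_product, mem_Icc] at h1
    exact ⟨abs_le.2 h1.1, h1.2, h2⟩
  let B : ℤ × ℕ → Finset ℕ := fun j => S.filter fun n =>
    ∃ k ∈ Icc (1 : ℤ) (L ^ 2 : ℕ), (μ n : ℤ) = j.1 + k * j.2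
  have hBS : ∀ j, ∀ n ∈ B j, n ∈ S ∧
      ∃ k ∈ Icc (1 : ℤ) (L ^ 2 : ℕ), (μ n : ℤ) = j.1 + k * j.2 := by
    intro j n hn
    simpa only [B, mem_filter] using hn
  have hL3 : 1 ≤ L ^ 3 := Nat.one_le_pow _ _ hL
  have hJcard : J.card ≤ 24 * L ^ 4 := by
    have hPL : P.card ≤ L := by
      calc P.card ≤ (Icc 1 L).card := card_le_card fun l hl =>
            mem_Icc.2 ⟨(hP l hl).2.1.one_le, (hP l hl).1⟩
        _ = L := by simp
    calc J.card ≤ (Icc (-(M : ℤ)) M ×ˢ P).card := card_filter_le _ _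
      _ = (2 * M + 1) * P.card := by
          rw [card_product, Int.card_Icc]; congr 1; omega
      _ ≤ (24 * L ^ 3) * L := Nat.mul_le_mul (by omega) hPL
      _ = _ := by ring
  have hlower : S.card * R * L ^ 2 ≤ ∑ j ∈ J, (B j).card := by
    have h1 : ∑ j ∈ J, (B j).card = ∑ n ∈ S, (J.filter fun j =>
        ∃ k ∈ Icc (1 : ℤ) (L ^ 2 : ℕ), (μ n : ℤ) = j.1 + k * j.2).card := by
      simp only [B]
      simp_rw [card_filter]
      rw [sum_comm]
    rw [h1, mul_assoc, ← smul_eq_mul, ← sum_const]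
    refine sum_le_sum fun n hn => ?_
    have hμn := mem_Icc.1 (hμ n hn)
    calc R * L ^ 2 ≤ ((Icc (1 : ℤ) (L ^ 2 : ℕ)) ×ˢ
          (Nat.primesLE L).filter fun l => ¬ l ∣ q ∧ ¬ l ∣ μ n).card := by
          rw [card_product, Int.card_Icc, mul_comm]
          exact Nat.mul_le_mul (by omega) (hR n hn)
      _ ≤ _ := by
          refine card_le_card_of_injOn (fun x => ((μ n : ℤ) - x.1 * x.2, x.2)) ?_ ?_
          · rintro ⟨k, l⟩ hx
            simp only [mem_coe, mem_product, mem_filter, Nat.mem_primesLE] at hx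
            obtain ⟨hk, ⟨hl, hlp⟩, hlq, hlμ⟩ := hx
            have hkI := mem_Icc.1 hk
            have h0 : 0 ≤ k * (l : ℤ) := mul_nonneg (by omega) (by omega)
            have h3 : k * (l : ℤ) ≤ M := by
              calc k * (l : ℤ) ≤ (L ^ 2 : ℕ) * (L : ℤ) := by
                    have : (l : ℤ) ≤ L := by exact_mod_cast hl
                    exact mul_le_mul hkI.2 this (by omega) (by omega)
                _ = (L ^ 3 : ℕ) := by push_cast; ring
                _ ≤ M := by exact_mod_cast hLM
            simp only [J, P, mem_coe, mem_filter, mem_product, mem_Icc, Nat.mem_primesLE]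
            refine ⟨⟨⟨⟨by omega, by omega⟩, ⟨hl, hlp⟩, hlq⟩, ?_⟩, k, hkI, by ring⟩
            have h4 : IsCoprime (μ n : ℤ) (l : ℤ) :=
              Nat.isCoprime_iff_coprime.2 ((Nat.Prime.coprime_iff_not_dvd hlp).2 hlμ).symm
            have h5 : (μ n : ℤ) - k * l = μ n + (-k) * l := by ring
            rw [h5]
            exact IsCoprime.add_mul_right_left h4 (-k)
          · rintro ⟨k, l⟩ hx ⟨k', l'⟩ hx' h
            simp only [mem_coe, mem_product, mem_filter, Nat.mem_primesLE] at hx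
            simp only [Prod.mk.injEq] at h ⊢
            obtain ⟨h, rfl⟩ := h
            have hl0 : (l : ℤ) ≠ 0 := by exact_mod_cast hx.2.1.2.ne_zero
            exact ⟨mul_right_cancel₀ hl0 (by linarith), rfl⟩
  have hE := sum_addEnergy_le (K := L ^ 2) hq hMLq hα J (fun j hj => (hJ j hj).1)
    (fun j hj => ⟨(hP _ (hJ j hj).2.1).2.1.one_le, (hP _ (hJ j hj).2.1).1⟩)
    (fun j hj => (hJ j hj).2.2)
    (fun j hj => (Nat.Prime.coprime_iff_not_dvd (hP _ (hJ j hj).2.1).2.1).2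
      (hP _ (hJ j hj).2.1).2.2) B (fun j _ n hn => hSq n (hBS j n hn).1)
    (fun j _ n hn => by
      obtain ⟨h1, k, hk, h2⟩ := hBS j n hn
      refine ⟨k, hk, ?_⟩
      rw [← hsol n h1]
      congr 1
      exact_mod_cast (congrArg (Int.cast : ℤ → ZMod q) h2).symm)
  have h4 := sum_card_pow_four_le J N B fun j _ n hn => hS n (hBS j n hn).1
  have hE' : ∑ j ∈ J, (B j).addEnergy (B j) ≤ 232 * 1536 ^ ω * L ^ 8 := by
    have h96 : 1 ≤ 96 ^ ω := Nat.one_le_pow _ _ (by norm_num)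
    have e1 : 12 ^ ω * 8 ^ ω = 96 ^ ω := by rw [← mul_pow]; norm_num
    have e2 : 16 ^ ω * 96 ^ ω = 1536 ^ ω := by rw [← mul_pow]; norm_num
    have e3 : (2 ^ ω) ^ 3 = 8 ^ ω := by rw [← pow_mul, mul_comm, pow_mul]; norm_num
    calc _ ≤ _ := hE
      _ ≤ 16 ^ ω * (24 * L ^ 4 * (3 * (L ^ 2) ^ 2) * 96 ^ ω +
          5 * 12 ^ ω * (4 * (L ^ 2 * (2 * L ^ 2 * 2 ^ ω) ^ 3))) := by
          refine Nat.mul_le_mul_left _ (Nat.add_le_add_right ?_ _)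
          calc J.card * (3 * (L ^ 2) ^ 2) ≤ 24 * L ^ 4 * (3 * (L ^ 2) ^ 2) := by gcongr
            _ ≤ _ := Nat.le_mul_of_pos_right _ h96
      _ = 16 ^ ω * (72 * L ^ 8 * 96 ^ ω + 160 * (12 ^ ω * (2 ^ ω) ^ 3) * L ^ 8) := by ring
      _ = 232 * (16 ^ ω * 96 ^ ω) * L ^ 8 := by rw [e3, e1]; ring
      _ = _ := by rw [e2]
  have hL8 : 0 < L ^ 8 := Nat.pow_pos hL
  refine Nat.le_of_mul_le_mul_right ?_ hL8
  calc (S.card * R) ^ 4 * L ^ 8 = (S.card * R * L ^ 2) ^ 4 := by ring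
    _ ≤ (∑ j ∈ J, (B j).card) ^ 4 := Nat.pow_le_pow_left hlower 4
    _ ≤ _ := h4
    _ ≤ (24 * L ^ 4) ^ 3 * (2 * N * (232 * 1536 ^ ω * L ^ 8)) := by gcongr
    _ = _ := by ring

theorem primesLE_card_le_add (L : ℕ) {q k : ℕ} (hq : q ≠ 0) (hk : k ≠ 0) :
    (Nat.primesLE L).card ≤ ((Nat.primesLE L).filter fun l => ¬ l ∣ q ∧ ¬ l ∣ k).card +
      (q.primeFactors.card + k.primeFactors.card) := by
  classical
  calc (Nat.primesLE L).card ≤ (((Nat.primesLE L).filter fun l => ¬ l ∣ q ∧ ¬ l ∣ k) ∪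
        (q.primeFactors ∪ k.primeFactors)).card := by
        refine card_le_card fun l hl => ?_
        have hp := (Nat.mem_primesLE.1 hl).2
        simp only [mem_union, mem_filter, Nat.mem_primeFactors]
        tauto
    _ ≤ _ := (card_union_le _ _).trans (Nat.add_le_add_left (card_union_le _ _) _)

theorem card_pairs_le {q m N : ℕ} (hq : Squarefree q) {α : ZMod q} (hα : IsUnit α) (hN : N < q) :
    (((Icc 1 m) ×ˢ (Icc 1 N)).filter fun p : ℕ × ℕ => Nat.gcd p.2 q = 1 ∧
      (p.1 : ZMod q) * (p.2 : ZMod q) ^ 2 = α).card ≤ m * 2 ^ q.primeFactors.card := by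
  classical
  rw [mul_comm]
  have h := card_le_mul_card_image_of_maps_to (f := Prod.fst) (t := Icc 1 m)
    (s := ((Icc 1 m) ×ˢ (Icc 1 N)).filter fun p : ℕ × ℕ => Nat.gcd p.2 q = 1 ∧
      (p.1 : ZMod q) * (p.2 : ZMod q) ^ 2 = α)
    (fun p hp => (mem_product.1 (mem_filter.1 hp).1).1) (2 ^ q.primeFactors.card) ?_
  · simpa using h
  · intro k _
    refine le_trans (card_le_card_of_injOn Prod.snd ?_ ?_) (card_filter_sq_mul_eq_le hq hα
      (Icc 1 N) (fun n hn => (mem_Icc.1 hn).2.trans_lt hN) (k : ZMod q))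
    · rintro ⟨a, n⟩ h
      simp only [mem_coe, mem_filter, mem_product] at h ⊢
      obtain ⟨⟨⟨-, hn⟩, -, h⟩, rfl⟩ := h
      exact ⟨hn, by rw [mul_comm]; exact h⟩
    · rintro ⟨a, n⟩ h ⟨b, n'⟩ h' hnn
      simp only [mem_coe, mem_filter] at h h'
      exact Prod.ext (h.2.trans h'.2.symm) hnn

theorem card_pairs_pow_four_mul_le {q L m N R : ℕ} (hq : Squarefree q) {α : ZMod q}
    (hα : IsUnit α) (hm : m < q) (hN : N < q) (hL : 1 ≤ L) (hLm : L ^ 3 ≤ m)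
    (hmL : m ≤ 8 * L ^ 3) (hmLq : m * L ≤ q)
    (hR : ∀ k ∈ Icc 1 m, R ≤ ((Nat.primesLE L).filter fun l => ¬ l ∣ q ∧ ¬ l ∣ k).card) :
    ((((Icc 1 m) ×ˢ (Icc 1 N)).filter fun p : ℕ × ℕ => Nat.gcd p.2 q = 1 ∧
      (p.1 : ZMod q) * (p.2 : ZMod q) ^ 2 = α).card * R) ^ 4 ≤
        6414336 * 1536 ^ q.primeFactors.card * N * L ^ 12 := by
  classical
  set P := ((Icc 1 m) ×ˢ (Icc 1 N)).filter fun p : ℕ × ℕ => Nat.gcd p.2 q = 1 ∧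
      (p.1 : ZMod q) * (p.2 : ZMod q) ^ 2 = α with hP
  have hinj : Set.InjOn Prod.snd (P : Set (ℕ × ℕ)) := by
    rintro ⟨a, n⟩ h ⟨b, n'⟩ h' rfl
    simp only [hP, mem_coe, mem_filter, mem_product, mem_Icc] at h h'
    have hu : IsUnit ((n : ZMod q) ^ 2) := ((ZMod.isUnit_iff_coprime _ _).2 h.2.1).pow 2
    have hab : (a : ZMod q) = b := hu.mul_right_cancel (h.2.2.trans h'.2.2.symm)
    exact Prod.ext (Nat.ModEq.eq_of_lt_of_lt ((ZMod.natCast_eq_natCast_iff _ _ _).1 hab)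
      (by omega) (by omega)) rfl
  have hS : ∀ n ∈ P.image Prod.snd, ∃ k, (k, n) ∈ P := by
    intro n hn
    obtain ⟨⟨k, n⟩, h, rfl⟩ := mem_image.1 hn
    exact ⟨k, h⟩
  choose! μ hμ using hS
  have hμ' : ∀ n ∈ P.image Prod.snd, (μ n ∈ Icc 1 m ∧ n ∈ Icc 1 N) ∧ Nat.gcd n q = 1 ∧
      (μ n : ZMod q) * (n : ZMod q) ^ 2 = α := by
    intro n hn
    simpa only [hP, mem_filter, mem_product] using hμ n hn
  rw [← card_image_of_injOn hinj]
  exact card_solutions_pow_four_mul_le hq hα hL hLm hmL hmLq _ (fun n hn => (hμ' n hn).1.2)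
    (fun n hn => (mem_Icc.1 (hμ' n hn).1.2).2.trans_lt hN) μ (fun n hn => (hμ' n hn).1.1)
    (fun n hn => by rw [mul_comm]; exact (hμ' n hn).2.2) (fun n hn => hR _ (hμ' n hn).1.1)

theorem exists_cube_le_lt {m : ℕ} (hm : 1 ≤ m) : ∃ L : ℕ, 1 ≤ L ∧ L ^ 3 ≤ m ∧ m ≤ 8 * L ^ 3 := by
  have h1 : (Nat.findGreatest (fun L => L ^ 3 ≤ m) m) ^ 3 ≤ m :=
    Nat.findGreatest_spec (P := fun L => L ^ 3 ≤ m) (m := 1) hm (by simpa using hm)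
  have h2 : 1 ≤ Nat.findGreatest (fun L => L ^ 3 ≤ m) m :=
    Nat.le_findGreatest hm (by simpa using hm)
  refine ⟨_, h2, h1, ?_⟩
  by_contra! h
  set L := Nat.findGreatest (fun L => L ^ 3 ≤ m) m with hL
  have h3 : (L + 1) ^ 3 ≤ m := by
    calc (L + 1) ^ 3 ≤ (2 * L) ^ 3 := Nat.pow_le_pow_left (by omega) 3
      _ = 8 * L ^ 3 := by ring
      _ ≤ m := h.le
  have h4 : L + 1 ≤ L := by
    conv_rhs => rw [hL]
    exact Nat.le_findGreatest ((Nat.le_self_pow (by norm_num) _).trans h3) h3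
  omega

/-- Pierce's bound for S_{1,-2}(M,N,q,a): for every ε > 0 there is C = C(ε) such that
for q squarefree, a a unit mod q, 1 ≤ M ≤ q^(3/4) and 1 ≤ N < q/2, the number of pairs
(m,n) of positive integers with m ≤ M, n ≤ N, gcd(n,q) = 1 and m·n² ≡ a (mod q) is at
most C · M^(2/3) · N^(1/4) · q^ε. -/
theorem pierce_bound_S_one_negtwo :
    ∀ ε : ℝ, 0 < ε → ∃ C : ℝ, 0 < C ∧
      ∀ q : ℕ, Squarefree q → ∀ a : (ZMod q)ˣ, ∀ M N : ℝ,
        1 ≤ M → M ≤ (q : ℝ) ^ ((3 : ℝ) / 4) → 1 ≤ N → N < (q : ℝ) / 2 →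
          ((((Finset.Icc 1 ⌊M⌋₊) ×ˢ (Finset.Icc 1 ⌊N⌋₊)).filter
              (fun p : ℕ × ℕ => Nat.gcd p.2 q = 1 ∧
                (p.1 : ZMod q) * (p.2 : ZMod q) ^ 2 = (a : ZMod q))).card : ℝ)
            ≤ C * M ^ ((2 : ℝ) / 3) * N ^ ((1 : ℝ) / 4) * (q : ℝ) ^ ε := by
  intro ε hε
  have hδ : 0 < ε / 3 := by positivity
  obtain ⟨C₁, hC₁, h₁⟩ := exists_pow_card_primeFactors_le 1536 hδ
  obtain ⟨C₂, hC₂, h₂⟩ := exists_le_rpow_mul_primesLE_card hδ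
  obtain ⟨C₃, hC₃, h₃⟩ := exists_pow_card_primeFactors_le 2 hδ
  refine ⟨24 * C₂ * C₃ * C₃ + 6 * C₂ * C₃ * (6414336 * C₁), by positivity, ?_⟩
  intro q hq a M N hM hMq hN hNq
  have hq0 : 0 < q := Nat.pos_of_ne_zero hq.ne_zero
  have hq1 : (1 : ℝ) < q := by linarith
  set m := ⌊M⌋₊ with hm
  have hm1 : 1 ≤ m := Nat.one_le_floor_iff M |>.2 hM
  have hmM : (m : ℝ) ≤ M := Nat.floor_le (by linarith)
  have hNN : (⌊N⌋₊ : ℝ) ≤ N := Nat.floor_le (by linarith)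
  have hNq' : ⌊N⌋₊ < q := by
    have : (⌊N⌋₊ : ℝ) < q := by linarith
    exact_mod_cast this
  have hm4 : m ^ 4 ≤ q ^ 3 := by
    have h : (m : ℝ) ^ 4 ≤ (q : ℝ) ^ 3 := by
      calc (m : ℝ) ^ 4 ≤ ((q : ℝ) ^ ((3 : ℝ) / 4)) ^ 4 := by gcongr; exact hmM.trans hMq
        _ = (q : ℝ) ^ 3 := by
          rw [← Real.rpow_mul_natCast (by positivity), ← Real.rpow_natCast]; norm_num
    exact_mod_cast h
  have hmq : m < q := by
    have hq1' : 1 < q := by exact_mod_cast hq1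
    by_contra! h
    have h1 := Nat.pow_le_pow_left h 4
    have h2 : q ^ 3 < q ^ 4 := Nat.pow_lt_pow_right hq1' (by norm_num)
    omega
  obtain ⟨L, hL, hLm, hmL⟩ := exists_cube_le_lt hm1
  have hmLq : m * L ≤ q := by
    refine (Nat.pow_le_pow_iff_left (n := 3) (by norm_num)).1 ?_
    calc (m * L) ^ 3 = m ^ 3 * L ^ 3 := by ring
      _ ≤ m ^ 3 * m := Nat.mul_le_mul_left _ hLm
      _ = m ^ 4 := by ring
      _ ≤ _ := hm4
  have hLm' : L ≤ m := (Nat.le_self_pow (by norm_num) L).trans hLm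
  set x : ℝ := (q : ℝ) ^ (ε / 3) with hx
  have hx1 : 1 ≤ x := Real.one_le_rpow hq1.le hδ.le
  have hx3 : x ^ 3 = (q : ℝ) ^ ε := by
    rw [hx, ← Real.rpow_mul_natCast (by positivity)]; norm_num
  have hmono : ∀ k : ℕ, k ≤ q → (k : ℝ) ^ (ε / 3) ≤ x := fun k hk =>
    Real.rpow_le_rpow (by positivity) (by exact_mod_cast hk) hδ.le
  set W : ℕ := ⌊C₃ * x⌋₊ with hW
  have hω : ∀ k : ℕ, k ≠ 0 → k ≤ q → k.primeFactors.card ≤ W := by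
    intro k hk hkq
    refine Nat.le_floor ?_
    calc (k.primeFactors.card : ℝ) ≤ (2 : ℕ) ^ k.primeFactors.card := by
          exact_mod_cast Nat.lt_two_pow_self.le
      _ ≤ C₃ * (k : ℝ) ^ (ε / 3) := h₃ k hk
      _ ≤ C₃ * x := by gcongr; exact hmono k hkq
  have hWx : (W : ℝ) ≤ C₃ * x := Nat.floor_le (by positivity)
  set R : ℕ := (Nat.primesLE L).card - 2 * W with hRdef
  have hR : ∀ k ∈ Icc 1 m,
      R ≤ ((Nat.primesLE L).filter fun l => ¬ l ∣ q ∧ ¬ l ∣ k).card := by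
    intro k hk
    rw [mem_Icc] at hk
    have e1 := primesLE_card_le_add L hq0.ne' (k := k) (by omega)
    have e2 := hω q hq0.ne' le_rfl
    have e3 := hω k (by omega) (by omega)
    omega
  have hLR : (L : ℝ) ≤ 3 * C₂ * C₃ * x ^ 2 * (R + 1) := by
    have hπ : (((Nat.primesLE L).card : ℕ) : ℝ) ≤ R + 2 * W := by
      have : (Nat.primesLE L).card ≤ R + 2 * W := by omega
      exact_mod_cast this
    have hCx : 1 ≤ C₃ * x := one_le_mul_of_one_le_of_one_le hC₃ hx1
    calc (L : ℝ) ≤ C₂ * (L : ℝ) ^ (ε / 3) * ((Nat.primesLE L).card + 1) := h₂ L hL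
      _ ≤ C₂ * x * (3 * (C₃ * x) * (R + 1)) := by
          gcongr
          · exact hmono L (by omega)
          · have : (0 : ℝ) ≤ R := Nat.cast_nonneg R
            nlinarith
      _ = _ := by ring
  have hL2 : (L : ℝ) ^ 2 ≤ M ^ ((2 : ℝ) / 3) := by
    have h : (L : ℝ) ^ 3 ≤ M := le_trans (by exact_mod_cast hLm) hmM
    calc (L : ℝ) ^ 2 = ((L : ℝ) ^ 3) ^ ((2 : ℝ) / 3) := by
          rw [← Real.rpow_natCast_mul (by positivity), ← Real.rpow_natCast]; norm_num
      _ ≤ _ := Real.rpow_le_rpow (by positivity) h (by norm_num)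
  have hN4 : 1 ≤ N ^ ((1 : ℝ) / 4) := Real.one_le_rpow hN (by norm_num)
  have hN44 : (N ^ ((1 : ℝ) / 4)) ^ 4 = N := by
    rw [← Real.rpow_mul_natCast (by positivity)]; norm_num
  have hb1 := card_pairs_le (m := m) hq a.isUnit hNq'
  have hb2 := card_pairs_pow_four_mul_le hq a.isUnit hmq hNq' hL hLm hmL hmLq hR
  set S := (((Finset.Icc 1 m) ×ˢ (Finset.Icc 1 ⌊N⌋₊)).filter
              (fun p : ℕ × ℕ => Nat.gcd p.2 q = 1 ∧
                (p.1 : ZMod q) * (p.2 : ZMod q) ^ 2 = (a : ZMod q))).card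
  rw [← hx3]
  have hL0 : (1 : ℝ) ≤ L := by exact_mod_cast hL
  rcases Nat.eq_zero_or_pos R with hR0 | hR1
  · rw [hR0, Nat.cast_zero, zero_add, mul_one] at hLR
    have hS : (S : ℝ) ≤ m * (2 : ℕ) ^ q.primeFactors.card := by exact_mod_cast hb1
    have hmL' : (m : ℝ) ≤ 8 * L ^ 3 := by exact_mod_cast hmL
    calc (S : ℝ) ≤ m * (2 : ℕ) ^ q.primeFactors.card := hS
      _ ≤ (8 * (L : ℝ) ^ 3) * (C₃ * x) := by
          gcongr
          exact h₃ q hq0.ne'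
      _ = 8 * C₃ * x * (L : ℝ) ^ 2 * L := by ring
      _ ≤ 8 * C₃ * x * M ^ ((2 : ℝ) / 3) * (3 * C₂ * C₃ * x ^ 2) := by gcongr
      _ = (24 * C₂ * C₃ * C₃) * M ^ ((2 : ℝ) / 3) * 1 * x ^ 3 := by ring
      _ ≤ _ := by
          gcongr
          have : 0 ≤ C₂ * C₃ * C₃ := by positivity
          have : 0 ≤ 6 * C₂ * C₃ * (6414336 * C₁) := by positivity
          linarith
  · have hR1' : (1 : ℝ) ≤ R := by exact_mod_cast hR1
    have hLR' : (L : ℝ) ≤ 6 * C₂ * C₃ * x ^ 2 * R := by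
      refine hLR.trans ?_
      calc 3 * C₂ * C₃ * x ^ 2 * ((R : ℝ) + 1) ≤ 3 * C₂ * C₃ * x ^ 2 * (2 * R) := by
            gcongr; linarith
        _ = _ := by ring
    have hS : ((S : ℝ) * R) ^ 4 ≤ 6414336 * (1536 : ℕ) ^ q.primeFactors.card * N * L ^ 12 := by
      refine le_trans ?_ (mul_le_mul_of_nonneg_right (mul_le_mul_of_nonneg_left hNN ?_) ?_)
      · exact_mod_cast hb2
      · positivity
      · positivity
    have hc : 1 ≤ 6414336 * C₁ := by linarith
    have hkey : (S : ℝ) ^ 4 ≤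
        (6 * C₂ * C₃ * (6414336 * C₁) * M ^ ((2 : ℝ) / 3) * N ^ ((1 : ℝ) / 4) * x ^ 3) ^ 4 := by
      have hL4 : (0 : ℝ) < (L : ℝ) ^ 4 := by positivity
      refine le_of_mul_le_mul_right ?_ hL4
      calc (S : ℝ) ^ 4 * L ^ 4 ≤ (S : ℝ) ^ 4 * (6 * C₂ * C₃ * x ^ 2 * R) ^ 4 := by gcongr
        _ = (6 * C₂ * C₃ * x ^ 2) ^ 4 * (S * R) ^ 4 := by ring
        _ ≤ (6 * C₂ * C₃ * x ^ 2) ^ 4 *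
            (6414336 * (1536 : ℕ) ^ q.primeFactors.card * N * L ^ 12) := by gcongr
        _ ≤ (6 * C₂ * C₃ * x ^ 2) ^ 4 * (6414336 * (C₁ * x) * N * L ^ 12) := by
            gcongr
            exact h₁ q hq0.ne'
        _ = (6 * C₂ * C₃ * x ^ 2) ^ 4 * N * ((L : ℝ) ^ 2) ^ 4 * (6414336 * C₁ * x) * L ^ 4 := by
            ring
        _ ≤ (6 * C₂ * C₃ * x ^ 2) ^ 4 * N * (M ^ ((2 : ℝ) / 3)) ^ 4 *
            (6414336 * C₁ * x) ^ 4 * L ^ 4 := by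
            gcongr
            exact le_self_pow₀ (one_le_mul_of_one_le_of_one_le hc hx1) (by norm_num)
        _ = (6 * C₂ * C₃ * x ^ 2) ^ 4 * (N ^ ((1 : ℝ) / 4)) ^ 4 * (M ^ ((2 : ℝ) / 3)) ^ 4 *
            (6414336 * C₁ * x) ^ 4 * L ^ 4 := by rw [hN44]
        _ = _ := by ring
    refine (le_of_pow_le_pow_left₀ (by norm_num) (by positivity) hkey).trans ?_
    gcongr
    have : 0 ≤ 24 * C₂ * C₃ * C₃ := by positivity
    linarith
end
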